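/- arXiv:1603.01734 — 3 statements merged into one kernel-verified Lean document; each statement's English description precedes it below -/
import Mathlib

section
/- For every η > 0 there exists a constant C > 0 with the following property. For every δ > 0 there exists n_0 such that for every Abelian group G of order n ≥ n_0, if U is a random subset of G with each element chosen independently with probability C n^{-2/3} (log n)^{1/3}, and μ is the characteristic measure of U, then with probability at least 1 − δ, M(μ) ≥ 1 − η. -/
open scoped Classical
open Finset

noncomputable section

/-- The weight of a particular outcome `A` when each element of a finite type `G`
is included independently with probability `p`. -/
def bernWeight {G : Type*} [Fintype G] (p : ℝ) (A : Finset G) : ℝ :=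
  p ^ A.card * (1 - p) ^ (Fintype.card G - A.card)

/-- The probability that a random subset of `G`, with each element chosen independently
with probability `p`, satisfies the event `E`. -/
def randomSubsetProb (G : Type*) [Fintype G] (p : ℝ) (E : Finset G → Prop) : ℝ :=
  ∑ A : Finset G, if E A then bernWeight p A else 0

/-- The set of non-degenerate additive quadruples `(x, y, z, w)` in `G`:
`x + y = z + w` and neither `x` nor `y` equals `z` or `w`. -/
def Gam (G : Type*) [AddCommGroup G] [Fintype G] : Finset (G × G × G × G) :=
  Finset.univ.filter fun q =>
    q.1 + q.2.1 = q.2.2.1 + q.2.2.2 ∧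
    q.1 ≠ q.2.2.1 ∧ q.1 ≠ q.2.2.2 ∧ q.2.1 ≠ q.2.2.1 ∧ q.2.1 ≠ q.2.2.2

/-- `M(μ) = E_{(x,y,z,w) ∈ Γ} μ(x) μ(y) μ(z) μ(w)` for a real-valued `μ`. -/
def MquadR {G : Type*} [AddCommGroup G] [Fintype G] (μ : G → ℝ) : ℝ :=
  (∑ q ∈ Gam G, μ q.1 * μ q.2.1 * μ q.2.2.1 * μ q.2.2.2) / ((Gam G).card : ℝ)

/-- The characteristic measure `(|G|/|U|) χ_U` of `U`. -/
def charMeas {G : Type*} [Fintype G] (U : Finset G) (x : G) : ℝ :=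
  if x ∈ U then (Fintype.card G : ℝ) / (U.card : ℝ) else 0

/-- The four elements of a quadruple. -/
def qset {G : Type*} (q : G × G × G × G) : Finset G := {q.1, q.2.1, q.2.2.1, q.2.2.2}

/-- Quadruples with four distinct entries. -/
def Dq (G : Type*) [AddCommGroup G] [Fintype G] : Finset (G × G × G × G) :=
  (Gam G).filter fun q => q.1 ≠ q.2.1 ∧ q.2.2.1 ≠ q.2.2.2

lemma bernWeight_nonneg {G : Type*} [Fintype G] {p : ℝ} (h0 : 0 ≤ p) (h1 : p ≤ 1)
    (A : Finset G) : 0 ≤ bernWeight p A := by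
  unfold bernWeight
  have : 0 ≤ 1 - p := by linarith
  positivity

lemma bern_superset {G : Type*} [Fintype G] (p : ℝ) (S : Finset G) :
    ∑ A : Finset G, bernWeight p A * (if S ⊆ A then 1 else 0) = p ^ S.card := by
  have h := Finset.prod_add (fun _ : G => p) (fun i => if i ∈ S then 0 else 1 - p) Finset.univ
  have hl : ∏ i : G, (p + if i ∈ S then 0 else 1 - p) = p ^ S.card := by
    have : ∀ i : G, (p + if i ∈ S then 0 else 1 - p) = if i ∈ S then p else 1 := by
      intro i; split_ifs <;> ring
    simp only [this]
    rw [Finset.prod_ite_mem]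
    simp
  rw [hl] at h
  rw [h, Finset.powerset_univ]
  refine Finset.sum_congr rfl fun A _ => ?_
  unfold bernWeight
  rw [Finset.prod_const]
  by_cases hS : S ⊆ A
  · have : ∏ i ∈ Finset.univ \ A, (if i ∈ S then 0 else 1 - p) = ∏ i ∈ Finset.univ \ A, (1 - p) := by
      refine Finset.prod_congr rfl fun i hi => ?_
      have : i ∉ S := fun h => (Finset.mem_sdiff.1 hi).2 (hS h)
      simp [this]
    rw [this, Finset.prod_const, Finset.card_univ_sdiff]
    simp [hS]
  · obtain ⟨i, hi, hiA⟩ := Finset.not_subset.1 hS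
    have : ∏ i ∈ Finset.univ \ A, (if i ∈ S then 0 else 1 - p) = 0 := by
      apply Finset.prod_eq_zero (i := i)
      · simp [hiA]
      · simp [hi]
    rw [this]; simp [hS]

lemma bern_total {G : Type*} [Fintype G] (p : ℝ) :
    ∑ A : Finset G, bernWeight p A = 1 := by
  have := bern_superset p (∅ : Finset G)
  simpa using this

/-- Number of members of a family contained in `A`. -/
def cnt {G ι : Type*} (D : Finset ι) (s : ι → Finset G) (A : Finset G) : ℝ :=
  ∑ i ∈ D, if s i ⊆ A then 1 else 0

lemma cnt_mean {G ι : Type*} [Fintype G] (p : ℝ) (D : Finset ι) (s : ι → Finset G) :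
    ∑ A : Finset G, bernWeight p A * cnt D s A = ∑ i ∈ D, p ^ (s i).card := by
  unfold cnt
  simp only [Finset.mul_sum]
  rw [Finset.sum_comm]
  refine Finset.sum_congr rfl fun i _ => ?_
  exact bern_superset p (s i)

lemma cnt_sq {G ι : Type*} [Fintype G] (p : ℝ) (D : Finset ι) (s : ι → Finset G) :
    ∑ A : Finset G, bernWeight p A * (cnt D s A) ^ 2
      = ∑ i ∈ D, ∑ j ∈ D, p ^ (s i ∪ s j).card := by
  unfold cnt
  simp only [sq]
  simp only [Finset.sum_mul_sum]
  simp only [Finset.mul_sum]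
  rw [Finset.sum_comm]
  refine Finset.sum_congr rfl fun i _ => ?_
  rw [Finset.sum_comm]
  refine Finset.sum_congr rfl fun j _ => ?_
  rw [← bern_superset p (s i ∪ s j)]
  refine Finset.sum_congr rfl fun A _ => ?_
  congr 1
  by_cases h1 : s i ⊆ A <;> by_cases h2 : s j ⊆ A <;> simp [h1, h2, Finset.union_subset_iff]

lemma cheb {G : Type*} [Fintype G] {p : ℝ} (h0 : 0 ≤ p) (h1 : p ≤ 1) (X : Finset G → ℝ)
    (m v ε : ℝ) (hm : 0 < m) (hε : 0 < ε)
    (hmean : ∑ A : Finset G, bernWeight p A * X A = m)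
    (hsq : ∑ A : Finset G, bernWeight p A * (X A) ^ 2 ≤ m ^ 2 * (1 + v)) :
    ∑ A : Finset G, bernWeight p A * (if ε * m ≤ |X A - m| then 1 else 0) ≤ v / ε ^ 2 := by
  have hvar : ∑ A : Finset G, bernWeight p A * (X A - m) ^ 2 ≤ m ^ 2 * v := by
    have : ∑ A : Finset G, bernWeight p A * (X A - m) ^ 2
        = ∑ A : Finset G, bernWeight p A * (X A) ^ 2
          - 2 * m * ∑ A : Finset G, bernWeight p A * X A
          + m ^ 2 * ∑ A : Finset G, bernWeight p A := by
      rw [Finset.mul_sum, Finset.mul_sum, ← Finset.sum_sub_distrib, ← Finset.sum_add_distrib]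
      refine Finset.sum_congr rfl fun A _ => ?_
      ring
    rw [this, hmean, bern_total]
    nlinarith
  have hle : (ε * m) ^ 2 * ∑ A : Finset G, bernWeight p A * (if ε * m ≤ |X A - m| then 1 else 0)
      ≤ ∑ A : Finset G, bernWeight p A * (X A - m) ^ 2 := by
    rw [Finset.mul_sum]
    refine Finset.sum_le_sum fun A _ => ?_
    have hw := bernWeight_nonneg h0 h1 A
    split_ifs with h
    · have : (ε * m) ^ 2 ≤ (X A - m) ^ 2 := by
        rw [← sq_abs (X A - m)]
        exact pow_le_pow_left₀ (by positivity) h 2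
      nlinarith
    · simp only [mul_zero]; positivity
  rw [le_div_iff₀ (by positivity)]
  have hm2 : 0 < m ^ 2 := by positivity
  have := hle.trans hvar
  refine le_of_mul_le_mul_left ?_ hm2
  calc _ = _ := by ring
    _ ≤ _ := this

section counting
variable {G : Type*} [AddCommGroup G] [Fintype G]

lemma mem_Dq (q : G × G × G × G) : q ∈ Dq G ↔
    (q.1 + q.2.1 = q.2.2.1 + q.2.2.2 ∧
    q.1 ≠ q.2.2.1 ∧ q.1 ≠ q.2.2.2 ∧ q.2.1 ≠ q.2.2.1 ∧ q.2.1 ≠ q.2.2.2) ∧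
    q.1 ≠ q.2.1 ∧ q.2.2.1 ≠ q.2.2.2 := by
  simp [Dq, Gam]

lemma card_qset {q : G × G × G × G} (hq : q ∈ Dq G) : (qset q).card = 4 := by
  rw [mem_Dq] at hq
  obtain ⟨⟨_, h1, h2, h3, h4⟩, h5, h6⟩ := hq
  unfold qset
  rw [Finset.card_insert_of_notMem, Finset.card_insert_of_notMem, Finset.card_insert_of_notMem,
    Finset.card_singleton] <;> simp [*]

lemma prod_qset {q : G × G × G × G} (hq : q ∈ Dq G) (g : G → ℝ) :
    ∏ i ∈ qset q, g i = g q.1 * g q.2.1 * g q.2.2.1 * g q.2.2.2 := by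
  rw [mem_Dq] at hq
  obtain ⟨⟨_, h1, h2, h3, h4⟩, h5, h6⟩ := hq
  unfold qset
  rw [Finset.prod_insert, Finset.prod_insert, Finset.prod_insert,
    Finset.prod_singleton]
  · ring
  all_goals simp [*]

lemma card_Gam_le : ((Gam G).card : ℝ) ≤ (Fintype.card G : ℝ) ^ 3 := by
  have : (Gam G).card ≤ (Finset.univ : Finset (G × G × G)).card := by
    apply Finset.card_le_card_of_injOn (fun q => (q.1, q.2.1, q.2.2.1))
    · intro q _; simp
    · rintro ⟨x, y, z, w⟩ h ⟨x', y', z', w'⟩ h' e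
      simp only [Finset.mem_coe, Gam, Finset.mem_filter, Finset.mem_univ, true_and,
        Prod.mk.injEq] at h h' e
      obtain ⟨rfl, rfl, rfl⟩ := e
      have := h.1.symm.trans h'.1
      simp_all
  have h2 : (Finset.univ : Finset (G × G × G)).card = Fintype.card G ^ 3 := by
    rw [Finset.card_univ, Fintype.card_prod, Fintype.card_prod]; ring
  rw [h2] at this
  exact_mod_cast this

lemma card_Dq_ge : (Fintype.card G : ℝ) ^ 3 - 4 * (Fintype.card G : ℝ) ^ 2 ≤ ((Dq G).card : ℝ) := by
  have hsub : (Finset.univ : Finset (G × G × G)) ⊆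
      (Dq G).image (fun q => (q.1, q.2.1, q.2.2.1)) ∪
      ((Finset.univ : Finset (G × G)).image (fun t => (t.1, t.1, t.2)) ∪
      ((Finset.univ : Finset (G × G)).image (fun t => (t.1, t.2, t.1)) ∪
      ((Finset.univ : Finset (G × G)).image (fun t => (t.1, t.2, t.2)) ∪
      (Finset.univ : Finset (G × G)).image (fun t => (t.1 + t.1 - t.2, t.2, t.1))))) := by
    rintro ⟨x, y, z⟩ _
    by_cases h1 : x = y
    · subst h1; simp
    by_cases h2 : x = z
    · subst h2; simp
    by_cases h3 : y = z
    · subst h3; simp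
    by_cases h4 : z + z - y = x
    · subst h4; simp
    apply Finset.mem_union_left
    rw [Finset.mem_image]
    refine ⟨(x, y, z, x + y - z), ?_, rfl⟩
    rw [mem_Dq]
    refine ⟨⟨?_, h2, ?_, h3, ?_⟩, h1, ?_⟩
    · simp
    · intro h; apply h3
      simp only at h
      have : x + y - z = x := h.symm
      rw [sub_eq_iff_eq_add] at this
      exact add_left_cancel this
    · intro h; apply h2
      have : x + y - z = y := h.symm
      rw [sub_eq_iff_eq_add, add_comm y z] at this
      exact add_right_cancel this
    · intro h; apply h4
      have : x + y - z = z := h.symm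
      rw [sub_eq_iff_eq_add] at this
      rw [← this]; simp
  have hc := Finset.card_le_card hsub
  have h2 : (Finset.univ : Finset (G × G × G)).card = Fintype.card G ^ 3 := by
    rw [Finset.card_univ, Fintype.card_prod, Fintype.card_prod]; ring
  have hi : ∀ f : G × G → G × G × G,
      ((Finset.univ : Finset (G × G)).image f).card ≤ Fintype.card G ^ 2 := by
    intro f
    refine Finset.card_image_le.trans ?_
    simp [Fintype.card_prod, sq]
  have hD : ((Dq G).image (fun q => (q.1, q.2.1, q.2.2.1))).card ≤ (Dq G).card :=
    Finset.card_image_le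
  have : Fintype.card G ^ 3 ≤ (Dq G).card + 4 * Fintype.card G ^ 2 := by
    rw [h2] at hc
    refine hc.trans ?_
    refine (Finset.card_union_le _ _).trans ?_
    have a1 := hi (fun t => (t.1, t.1, t.2))
    have a2 := hi (fun t => (t.1, t.2, t.1))
    have a3 := hi (fun t => (t.1, t.2, t.2))
    have a4 := hi (fun t => (t.1 + t.1 - t.2, t.2, t.1))
    have b1 := Finset.card_union_le ((Finset.univ : Finset (G × G)).image (fun t => (t.1, t.2, t.2)))
      ((Finset.univ : Finset (G × G)).image (fun t => (t.1 + t.1 - t.2, t.2, t.1)))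
    have b2 := Finset.card_union_le ((Finset.univ : Finset (G × G)).image (fun t => (t.1, t.2, t.1)))
      (((Finset.univ : Finset (G × G)).image (fun t => (t.1, t.2, t.2))) ∪
      ((Finset.univ : Finset (G × G)).image (fun t => (t.1 + t.1 - t.2, t.2, t.1))))
    have b3 := Finset.card_union_le ((Finset.univ : Finset (G × G)).image (fun t => (t.1, t.1, t.2)))
      (((Finset.univ : Finset (G × G)).image (fun t => (t.1, t.2, t.1))) ∪
      (((Finset.univ : Finset (G × G)).image (fun t => (t.1, t.2, t.2))) ∪
      ((Finset.univ : Finset (G × G)).image (fun t => (t.1 + t.1 - t.2, t.2, t.1)))))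
    omega
  have : (Fintype.card G : ℝ) ^ 3 ≤ (Dq G).card + 4 * (Fintype.card G : ℝ) ^ 2 := by
    exact_mod_cast this
  linarith

lemma triple_sum (φ : G × G × G × G → G × G × G) (hφ : Set.InjOn φ (Dq G)) (a b c : G → ℝ)
    (ha : ∀ x, 0 ≤ a x) (hb : ∀ x, 0 ≤ b x) (hc : ∀ x, 0 ≤ c x) :
    ∑ q ∈ Dq G, a (φ q).1 * b (φ q).2.1 * c (φ q).2.2 ≤ (∑ x, a x) * (∑ x, b x) * (∑ x, c x) := by
  have h1 : ∑ q ∈ Dq G, a (φ q).1 * b (φ q).2.1 * c (φ q).2.2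
      = ∑ t ∈ (Dq G).image φ, a t.1 * b t.2.1 * c t.2.2 := by
    rw [Finset.sum_image hφ]
  rw [h1]
  have h2 : ∑ t ∈ (Dq G).image φ, a t.1 * b t.2.1 * c t.2.2
      ≤ ∑ t : G × G × G, a t.1 * b t.2.1 * c t.2.2 := by
    apply Finset.sum_le_sum_of_subset_of_nonneg (Finset.subset_univ _)
    intro t _ _
    exact mul_nonneg (mul_nonneg (ha _) (hb _)) (hc _)
  refine h2.trans (le_of_eq ?_)
  rw [Fintype.sum_prod_type, mul_assoc, Finset.sum_mul]
  refine Finset.sum_congr rfl fun x _ => ?_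
  rw [Fintype.sum_prod_type, Finset.sum_mul_sum, Finset.mul_sum]
  refine Finset.sum_congr rfl fun y _ => ?_
  rw [Finset.mul_sum]
  refine Finset.sum_congr rfl fun z _ => ?_
  ring

lemma quad_sum (h : G → ℝ) (K H : ℝ) (hh : ∀ x, 0 ≤ h x) (hK : ∀ x, 1 + h x ≤ K)
    (hH : ∑ x, h x = H) :
    ∑ q ∈ Dq G, (1 + h q.1) * (1 + h q.2.1) * (1 + h q.2.2.1) * (1 + h q.2.2.2) ≤
      ((Fintype.card G : ℝ) + H) ^ 3 + ((Fintype.card G : ℝ) + H) ^ 2 * H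
        + ((Fintype.card G : ℝ) + H) * H ^ 2 + H ^ 3 * K := by
  set n : ℝ := (Fintype.card G : ℝ) with hn
  have hg : ∑ x, (1 + h x) = n + H := by
    rw [Finset.sum_add_distrib, hH]; simp [hn]
  have hg0 : ∀ x, 0 ≤ 1 + h x := fun x => by linarith [hh x]
  have inj1 : Set.InjOn (fun q : G × G × G × G => (q.1, q.2.1, q.2.2.1)) (Dq G) := by
    rintro ⟨x, y, z, w⟩ h1 ⟨x', y', z', w'⟩ h2 e
    simp only [Finset.mem_coe, mem_Dq, Prod.mk.injEq] at h1 h2 e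
    obtain ⟨rfl, rfl, rfl⟩ := e
    have := h1.1.1.symm.trans h2.1.1
    simp_all
  have inj2 : Set.InjOn (fun q : G × G × G × G => (q.1, q.2.1, q.2.2.2)) (Dq G) := by
    rintro ⟨x, y, z, w⟩ h1 ⟨x', y', z', w'⟩ h2 e
    simp only [Finset.mem_coe, mem_Dq, Prod.mk.injEq] at h1 h2 e
    obtain ⟨rfl, rfl, rfl⟩ := e
    have := h1.1.1.symm.trans h2.1.1
    simp_all
  have inj3 : Set.InjOn (fun q : G × G × G × G => (q.1, q.2.2.1, q.2.2.2)) (Dq G) := by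
    rintro ⟨x, y, z, w⟩ h1 ⟨x', y', z', w'⟩ h2 e
    simp only [Finset.mem_coe, mem_Dq, Prod.mk.injEq] at h1 h2 e
    obtain ⟨rfl, rfl, rfl⟩ := e
    have := h1.1.1.trans h2.1.1.symm
    rw [add_left_cancel this]
  have inj4 : Set.InjOn (fun q : G × G × G × G => (q.2.1, q.2.2.1, q.2.2.2)) (Dq G) := by
    rintro ⟨x, y, z, w⟩ h1 ⟨x', y', z', w'⟩ h2 e
    simp only [Finset.mem_coe, mem_Dq, Prod.mk.injEq] at h1 h2 e
    obtain ⟨rfl, rfl, rfl⟩ := e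
    have := h1.1.1.trans h2.1.1.symm
    rw [add_right_cancel this]
  have t1 := triple_sum _ inj1 (fun x => 1 + h x) (fun x => 1 + h x) (fun x => 1 + h x) hg0 hg0 hg0
  have t2 := triple_sum _ inj2 (fun x => 1 + h x) (fun x => 1 + h x) h hg0 hg0 hh
  have t3 := triple_sum _ inj3 (fun x => 1 + h x) h h hg0 hh hh
  have t4 := triple_sum _ inj4 h h (fun x => h x * K) hh hh
    (fun x => mul_nonneg (hh x) ((hg0 x).trans (hK x)))
  rw [← Finset.sum_mul] at t4
  rw [hg] at t1 t2 t3
  rw [hH] at t2 t3 t4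
  have key : ∑ q ∈ Dq G, (1 + h q.1) * (1 + h q.2.1) * (1 + h q.2.2.1) * (1 + h q.2.2.2) ≤
      ∑ q ∈ Dq G, ((1 + h q.1) * (1 + h q.2.1) * (1 + h q.2.2.1)
        + (1 + h q.1) * (1 + h q.2.1) * h q.2.2.2
        + (1 + h q.1) * h q.2.2.1 * h q.2.2.2
        + h q.2.1 * h q.2.2.1 * (h q.2.2.2 * K)) := by
    refine Finset.sum_le_sum fun q _ => ?_
    have : (1 + h q.1) * (h q.2.1 * h q.2.2.1 * h q.2.2.2)
        ≤ K * (h q.2.1 * h q.2.2.1 * h q.2.2.2) :=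
      mul_le_mul_of_nonneg_right (hK _) (mul_nonneg (mul_nonneg (hh _) (hh _)) (hh _))
    nlinarith [this]
  simp only [Finset.sum_add_distrib] at key
  simp only at t1 t2 t3 t4
  calc _ ≤ _ := key
    _ ≤ _ := add_le_add (add_le_add (add_le_add t1 t2) t3) t4
    _ = _ := by ring

lemma pair_sum {p : ℝ} (h0 : 0 < p) (h1 : p ≤ 1) {q : G × G × G × G} (hq : q ∈ Dq G) :
    ∑ q' ∈ Dq G, p ^ (qset q ∪ qset q').card ≤ p ^ 8 *
      (((Fintype.card G : ℝ) + 4 / p) ^ 3 + ((Fintype.card G : ℝ) + 4 / p) ^ 2 * (4 / p)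
        + ((Fintype.card G : ℝ) + 4 / p) * (4 / p) ^ 2 + (4 / p) ^ 3 * (1 / p)) := by
  set h : G → ℝ := fun x => if x ∈ qset q then 1 / p - 1 else 0 with hh
  have hp1 : 1 ≤ 1 / p := by rw [le_div_iff₀ h0]; linarith
  have hnn : ∀ x, 0 ≤ h x := by
    intro x; simp only [hh]; split_ifs <;> linarith
  have hK : ∀ x, 1 + h x ≤ 1 / p := by
    intro x; simp only [hh]; split_ifs <;> linarith
  have hsum : ∑ x, h x = 4 * (1 / p - 1) := by
    simp only [hh]
    rw [Finset.sum_ite_mem]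
    simp [card_qset hq]
    ring
  have hle : 4 * (1 / p - 1) ≤ 4 / p := by
    have : 4 / p = 4 * (1 / p) := by ring
    linarith
  have hge : 0 ≤ 4 * (1 / p - 1) := by linarith
  have hQ := quad_sum h (1 / p) _ hnn hK hsum
  have hterm : ∀ q' ∈ Dq G, p ^ (qset q ∪ qset q').card =
      p ^ 8 * ((1 + h q'.1) * (1 + h q'.2.1) * (1 + h q'.2.2.1) * (1 + h q'.2.2.2)) := by
    intro q' hq'
    rw [← prod_qset hq' (fun x => 1 + h x)]
    have e1 : ∀ x, 1 + h x = if x ∈ qset q then 1 / p else 1 := by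
      intro x; simp only [hh]; split_ifs <;> ring
    simp only [e1]
    rw [Finset.prod_ite_mem, Finset.prod_const]
    have hc := Finset.card_union_add_card_inter (qset q) (qset q')
    rw [card_qset hq, card_qset hq'] at hc
    rw [Finset.inter_comm (qset q') (qset q)]
    have : p ^ 8 = p ^ (qset q ∪ qset q').card * p ^ (qset q ∩ qset q').card := by
      rw [← pow_add, hc]
    rw [this, mul_assoc, ← mul_pow, mul_one_div_cancel h0.ne', one_pow, mul_one]
  rw [Finset.sum_congr rfl hterm, ← Finset.mul_sum]
  apply mul_le_mul_of_nonneg_left _ (by positivity)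
  refine hQ.trans ?_
  gcongr

lemma M_ge (U : Finset G) :
    ((Fintype.card G : ℝ) / U.card) ^ 4 * cnt (Dq G) qset U / (Gam G).card
      ≤ MquadR (charMeas U) := by
  unfold MquadR
  apply div_le_div_of_nonneg_right _ (Nat.cast_nonneg _)
  have hnn : ∀ x, 0 ≤ charMeas U x := by
    intro x; unfold charMeas; split_ifs <;> positivity
  have h1 : ∑ q ∈ Dq G, charMeas U q.1 * charMeas U q.2.1 * charMeas U q.2.2.1 * charMeas U q.2.2.2
      ≤ ∑ q ∈ Gam G, charMeas U q.1 * charMeas U q.2.1 * charMeas U q.2.2.1 * charMeas U q.2.2.2 := by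
    apply Finset.sum_le_sum_of_subset_of_nonneg (Finset.filter_subset _ _)
    intro q _ _
    exact mul_nonneg (mul_nonneg (mul_nonneg (hnn _) (hnn _)) (hnn _)) (hnn _)
  refine le_trans ?_ h1
  unfold cnt
  rw [Finset.mul_sum]
  refine Finset.sum_le_sum fun q _ => ?_
  split_ifs with hs
  · have : q.1 ∈ U ∧ q.2.1 ∈ U ∧ q.2.2.1 ∈ U ∧ q.2.2.2 ∈ U := by
      refine ⟨hs ?_, hs ?_, hs ?_, hs ?_⟩ <;> simp [qset]
    obtain ⟨a, b, c, d⟩ := this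
    simp only [charMeas, a, b, c, d, if_true]
    apply le_of_eq; ring
  · rw [mul_zero]
    exact mul_nonneg (mul_nonneg (mul_nonneg (hnn _) (hnn _)) (hnn _)) (hnn _)

end counting

/-- The relative second-moment error. -/
def vfun (a b c : ℝ) : ℝ :=
  ((1 + 4 * a) ^ 3 + (1 + 4 * a) ^ 2 * (4 * a) + (1 + 4 * a) * (4 * a) ^ 2 + 64 * b) / (1 - 4 * c) - 1

lemma main_bound {G : Type*} [AddCommGroup G] [Fintype G] {p ε η δ : ℝ} (h0 : 0 < p) (h1 : p ≤ 1)
    (hε : 0 < ε) (hε1 : ε < 1) (hεη : 6 * ε ≤ η)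
    (hn : 0 < (Fintype.card G : ℝ)) (hc : 4 * (1 / (Fintype.card G : ℝ)) ≤ ε)
    (ha : (1 / ((Fintype.card G : ℝ) * p)) / ε ^ 2 ≤ δ / 2)
    (hv : vfun (1 / ((Fintype.card G : ℝ) * p)) (1 / ((Fintype.card G : ℝ) ^ 3 * p ^ 4))
      (1 / (Fintype.card G : ℝ)) / ε ^ 2 ≤ δ / 2) :
    1 - δ ≤ randomSubsetProb G p (fun U => 1 - η ≤ MquadR (charMeas U)) := by
  set n : ℝ := (Fintype.card G : ℝ) with hnd
  set N : ℝ := ((Dq G).card : ℝ) with hN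
  have hNge : n ^ 3 * (1 - 4 * (1 / n)) ≤ N := by
    have := card_Dq_ge (G := G)
    rw [← hnd] at this
    refine le_trans (le_of_eq ?_) this
    field_simp
  have hc1 : 0 < 1 - 4 * (1 / n) := by linarith
  have hNge' : n ^ 3 * (1 - ε) ≤ N :=
    le_trans (mul_le_mul_of_nonneg_left (by linarith) (by positivity)) hNge
  have hNpos : 0 < N := lt_of_lt_of_le (by positivity) hNge
  -- quadruple count
  have mean1 : ∑ A : Finset G, bernWeight p A * cnt (Dq G) qset A = N * p ^ 4 := by
    rw [cnt_mean, Finset.sum_congr rfl (fun q hq => by rw [card_qset hq])]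
    simp [hN]
  set T : ℝ := (n + 4 / p) ^ 3 + (n + 4 / p) ^ 2 * (4 / p)
        + (n + 4 / p) * (4 / p) ^ 2 + (4 / p) ^ 3 * (1 / p) with hT
  have hTn : T = n ^ 3 * ((1 + 4 * (1 / (n * p))) ^ 3
      + (1 + 4 * (1 / (n * p))) ^ 2 * (4 * (1 / (n * p)))
      + (1 + 4 * (1 / (n * p))) * (4 * (1 / (n * p))) ^ 2 + 64 * (1 / (n ^ 3 * p ^ 4))) := by
    rw [hT]; field_simp; ring
  have hT0 : 0 ≤ T := by rw [hT]; positivity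
  have hTN : T ≤ N * (1 + vfun (1 / (n * p)) (1 / (n ^ 3 * p ^ 4)) (1 / n)) := by
    have : 1 + vfun (1 / (n * p)) (1 / (n ^ 3 * p ^ 4)) (1 / n)
        = T / (n ^ 3 * (1 - 4 * (1 / n))) := by
      rw [hTn]; unfold vfun
      rw [mul_div_mul_left _ _ (by positivity : n ^ 3 ≠ 0)]; ring
    rw [this, mul_div_assoc', le_div_iff₀ (by positivity), mul_comm]
    exact mul_le_mul_of_nonneg_right hNge hT0
  have sq1 : ∑ A : Finset G, bernWeight p A * (cnt (Dq G) qset A) ^ 2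
      ≤ (N * p ^ 4) ^ 2 * (1 + vfun (1 / (n * p)) (1 / (n ^ 3 * p ^ 4)) (1 / n)) := by
    rw [cnt_sq]
    have : ∑ i ∈ Dq G, ∑ j ∈ Dq G, p ^ (qset i ∪ qset j).card ≤ ∑ i ∈ Dq G, p ^ 8 * T :=
      Finset.sum_le_sum fun q hq => pair_sum h0 h1 hq
    refine this.trans ?_
    rw [Finset.sum_const, nsmul_eq_mul]
    calc N * (p ^ 8 * T) = (N * p ^ 8) * T := by ring
      _ ≤ (N * p ^ 8) * (N * (1 + vfun (1 / (n * p)) (1 / (n ^ 3 * p ^ 4)) (1 / n))) :=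
        mul_le_mul_of_nonneg_left hTN (by positivity)
      _ = _ := by ring
  have ch1 := cheb h0.le h1 (cnt (Dq G) qset) (N * p ^ 4) _ ε (by positivity) hε mean1 sq1
  -- size
  have mean2 : ∑ A : Finset G, bernWeight p A * cnt Finset.univ (fun x : G => {x}) A = n * p := by
    rw [cnt_mean]
    simp [hnd]
  have sq2 : ∑ A : Finset G, bernWeight p A * (cnt Finset.univ (fun x : G => {x}) A) ^ 2
      ≤ (n * p) ^ 2 * (1 + 1 / (n * p)) := by
    rw [cnt_sq]
    have hx : ∀ x : G, ∑ y : G, p ^ (({x} : Finset G) ∪ {y}).card ≤ n * p ^ 2 + p := by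
      intro x
      have : ∀ y : G, p ^ (({x} : Finset G) ∪ {y}).card ≤ p ^ 2 + if x = y then p else 0 := by
        intro y
        by_cases hxy : x = y
        · subst hxy; simp; positivity
        · have : (({x} : Finset G) ∪ {y}).card = 2 := by
            have := Finset.card_pair hxy
            rwa [Finset.insert_eq] at this
          rw [this]; simp [hxy]
      refine (Finset.sum_le_sum fun y _ => this y).trans ?_
      rw [Finset.sum_add_distrib]; simp [hnd]
    refine (Finset.sum_le_sum fun x _ => hx x).trans ?_
    rw [Finset.sum_const, nsmul_eq_mul, Finset.card_univ, ← hnd]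
    apply le_of_eq; field_simp
  have ch2 := cheb h0.le h1 (cnt Finset.univ (fun x : G => {x})) (n * p) _ ε (by positivity) hε
    mean2 sq2
  have hcard : ∀ A : Finset G, cnt Finset.univ (fun x : G => {x}) A = A.card := by
    intro A; unfold cnt; simp
  -- deterministic
  have good : ∀ A : Finset G, ¬ (ε * (N * p ^ 4) ≤ |cnt (Dq G) qset A - N * p ^ 4|) →
      ¬ (ε * (n * p) ≤ |cnt Finset.univ (fun x : G => {x}) A - n * p|) →
      1 - η ≤ MquadR (charMeas A) := by
    intro A hA1 hA2
    rw [hcard] at hA2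
    push Not at hA1 hA2
    rw [abs_lt] at hA1 hA2
    have hX : (1 - ε) * (N * p ^ 4) ≤ cnt (Dq G) qset A := by linarith [hA1.1]
    have hY : (A.card : ℝ) ≤ (1 + ε) * (n * p) := by linarith [hA2.2]
    have hY0 : 0 < (A.card : ℝ) := by
      have : 0 < (1 - ε) * (n * p) := mul_pos (by linarith) (by positivity)
      linarith [hA2.1]
    refine le_trans ?_ (M_ge A)
    rw [← hnd]
    have hG : ((Gam G).card : ℝ) ≤ n ^ 3 := card_Gam_le
    have hG0 : 0 < ((Gam G).card : ℝ) := by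
      have : N ≤ ((Gam G).card : ℝ) := by
        rw [hN]; exact_mod_cast Finset.card_le_card (Finset.filter_subset _ _)
      linarith
    have he : 0 < 1 - ε := by linarith
    have hr : (1 - ε) / p ≤ n / A.card := by
      rw [div_le_div_iff₀ h0 hY0]
      calc (1 - ε) * A.card ≤ (1 - ε) * ((1 + ε) * (n * p)) :=
            mul_le_mul_of_nonneg_left hY he.le
        _ = (1 - ε ^ 2) * (n * p) := by ring
        _ ≤ 1 * (n * p) := mul_le_mul_of_nonneg_right (by nlinarith) (by positivity)
        _ = n * p := one_mul _
    have hb : 1 - η ≤ (1 - ε) ^ 6 := by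
      have := one_add_mul_le_pow (a := -ε) (by linarith) 6
      have e : (1 + -ε) ^ 6 = (1 - ε) ^ 6 := by ring
      rw [e] at this
      push_cast at this
      linarith
    refine hb.trans ?_
    rw [le_div_iff₀ hG0]
    have hXpos : (1 - ε) * (n ^ 3 * (1 - ε) * p ^ 4) ≤ cnt (Dq G) qset A :=
      le_trans (mul_le_mul_of_nonneg_left
        (mul_le_mul_of_nonneg_right hNge' (by positivity)) he.le) hX
    calc (1 - ε) ^ 6 * ((Gam G).card : ℝ) ≤ (1 - ε) ^ 6 * n ^ 3 :=
          mul_le_mul_of_nonneg_left hG (by positivity)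
      _ = ((1 - ε) / p) ^ 4 * ((1 - ε) * (n ^ 3 * (1 - ε) * p ^ 4)) := by
          field_simp
      _ ≤ (n / A.card) ^ 4 * cnt (Dq G) qset A := by
          apply mul_le_mul _ hXpos (by positivity) (by positivity)
          exact pow_le_pow_left₀ (by positivity) hr 4
  have hfin : (1 : ℝ) ≤ randomSubsetProb G p (fun U => 1 - η ≤ MquadR (charMeas U))
      + ∑ A : Finset G, bernWeight p A *
          (if ε * (N * p ^ 4) ≤ |cnt (Dq G) qset A - N * p ^ 4| then 1 else 0)
      + ∑ A : Finset G, bernWeight p A *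
          (if ε * (n * p) ≤ |cnt Finset.univ (fun x : G => {x}) A - n * p| then 1 else 0) := by
    refine (bern_total (G := G) p).symm.le.trans ?_
    unfold randomSubsetProb
    rw [← Finset.sum_add_distrib, ← Finset.sum_add_distrib]
    refine Finset.sum_le_sum fun A _ => ?_
    have hw := bernWeight_nonneg h0.le h1 A
    have hgood := good A
    by_cases c1 : ε * (N * p ^ 4) ≤ |cnt (Dq G) qset A - N * p ^ 4|
    · rw [if_pos c1]
      split_ifs <;> linarith
    · by_cases c2 : ε * (n * p) ≤ |cnt Finset.univ (fun x : G => {x}) A - n * p|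
      · rw [if_pos c2]
        split_ifs <;> linarith
      · rw [if_pos (hgood c1 c2)]
        split_ifs <;> linarith
  linarith

/-- The probability with `C = 1`. -/
def pfun (n : ℕ) : ℝ := 1 * (n : ℝ) ^ (-(2 : ℝ) / 3) * Real.log n ^ ((1 : ℝ) / 3)

lemma pfun_facts (n : ℕ) (hn : 3 ≤ n) : 0 < pfun n ∧ pfun n ≤ 1 ∧
    (n : ℝ) ^ ((1 : ℝ) / 3) ≤ n * pfun n ∧ (n : ℝ) ^ ((1 : ℝ) / 3) ≤ (n : ℝ) ^ 3 * pfun n ^ 4 := by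
  have hn3 : (3 : ℝ) ≤ n := by exact_mod_cast hn
  have hn0 : (0 : ℝ) < n := by linarith
  have hlog : 1 ≤ Real.log n := by
    rw [Real.le_log_iff_exp_le hn0]
    linarith [Real.exp_one_lt_d9]
  have hlogn : Real.log n ≤ n := (Real.log_le_sub_one_of_pos hn0).trans (by linarith)
  have hL1 : 1 ≤ Real.log n ^ ((1 : ℝ) / 3) := Real.one_le_rpow hlog (by norm_num)
  have hL2 : Real.log n ^ ((1 : ℝ) / 3) ≤ (n : ℝ) ^ ((1 : ℝ) / 3) :=
    Real.rpow_le_rpow (by linarith) hlogn (by norm_num)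
  have hp0 : 0 < (n : ℝ) ^ (-(2 : ℝ) / 3) := Real.rpow_pos_of_pos hn0 _
  have hpge : (n : ℝ) ^ (-(2 : ℝ) / 3) ≤ pfun n := by
    unfold pfun; nlinarith
  refine ⟨lt_of_lt_of_le hp0 hpge, ?_, ?_, ?_⟩
  · unfold pfun
    rw [one_mul]
    calc _ ≤ (n : ℝ) ^ (-(2 : ℝ) / 3) * (n : ℝ) ^ ((1 : ℝ) / 3) :=
          mul_le_mul_of_nonneg_left hL2 hp0.le
      _ = (n : ℝ) ^ (-(1 : ℝ) / 3) := by rw [← Real.rpow_add hn0]; norm_num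
      _ ≤ 1 := Real.rpow_le_one_of_one_le_of_nonpos (by linarith) (by norm_num)
  · calc (n : ℝ) ^ ((1 : ℝ) / 3) = n * (n : ℝ) ^ (-(2 : ℝ) / 3) := by
          nth_rewrite 2 [← Real.rpow_one (n : ℝ)]
          rw [← Real.rpow_add hn0]; norm_num
      _ ≤ _ := mul_le_mul_of_nonneg_left hpge hn0.le
  · calc (n : ℝ) ^ ((1 : ℝ) / 3) = (n : ℝ) ^ 3 * ((n : ℝ) ^ (-(2 : ℝ) / 3)) ^ 4 := by
          rw [← Real.rpow_natCast, ← Real.rpow_natCast, ← Real.rpow_mul hn0.le,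
            ← Real.rpow_add hn0]
          norm_num
      _ ≤ _ := by gcongr

open Filter Topology in
lemma tendsto_facts :
    Tendsto (fun n : ℕ => 1 / ((n : ℝ) * pfun n)) atTop (𝓝 0) ∧
    Tendsto (fun n : ℕ => 1 / ((n : ℝ) ^ 3 * pfun n ^ 4)) atTop (𝓝 0) := by
  have h : Tendsto (fun n : ℕ => (n : ℝ) ^ ((1 : ℝ) / 3)) atTop atTop :=
    (tendsto_rpow_atTop (by norm_num)).comp tendsto_natCast_atTop_atTop
  constructor
  · simp only [one_div]
    apply Tendsto.inv_tendsto_atTop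
    refine tendsto_atTop_mono' _ ?_ h
    filter_upwards [eventually_ge_atTop 3] with n hn
    exact (pfun_facts n hn).2.2.1
  · simp only [one_div]
    apply Tendsto.inv_tendsto_atTop
    refine tendsto_atTop_mono' _ ?_ h
    filter_upwards [eventually_ge_atTop 3] with n hn
    exact (pfun_facts n hn).2.2.2

open Filter Topology in
lemma vfun_tendsto :
    Tendsto (fun n : ℕ => vfun (1 / ((n : ℝ) * pfun n)) (1 / ((n : ℝ) ^ 3 * pfun n ^ 4))
      (1 / (n : ℝ))) atTop (𝓝 0) := by
  have ha := tendsto_facts.1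
  have hb := tendsto_facts.2
  have hc : Tendsto (fun n : ℕ => 1 / (n : ℝ)) atTop (𝓝 0) := tendsto_one_div_atTop_nhds_zero_nat
  have h4a := (ha.const_mul 4)
  have h1a := h4a.const_add 1
  have := ((((((h1a.pow 3).add ((h1a.pow 2).mul h4a)).add (h1a.mul (h4a.pow 2))).add
    (hb.const_mul 64))).div ((hc.const_mul 4).const_sub 1) (by norm_num)).sub_const 1
  unfold vfun
  convert this using 2
  all_goals norm_num

theorem M_of_characteristic_measure_large (η : ℝ) (hη : 0 < η) :
    ∃ C : ℝ, 0 < C ∧ ∀ δ : ℝ, 0 < δ → ∃ n₀ : ℕ,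
      ∀ (G : Type) [AddCommGroup G] [Fintype G], n₀ ≤ Fintype.card G →
        1 - δ ≤ randomSubsetProb G
            (C * (Fintype.card G : ℝ) ^ (-(2 : ℝ) / 3) *
              Real.log (Fintype.card G) ^ ((1 : ℝ) / 3))
            (fun U => 1 - η ≤ MquadR (charMeas U)) := by
  refine ⟨1, one_pos, fun δ hδ => ?_⟩
  set ε : ℝ := min (η / 6) (1 / 2) with hεd
  have hε : 0 < ε := lt_min (by linarith) (by norm_num)
  have hε1 : ε < 1 := lt_of_le_of_lt (min_le_right _ _) (by norm_num)
  have hεη : 6 * ε ≤ η := by linarith [min_le_left (η / 6) (1 / 2 : ℝ)]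
  have e1 := (tendsto_facts.1.div_const (ε ^ 2)).eventually_le_const
    (show 0 / ε ^ 2 < δ / 2 by rw [zero_div]; linarith)
  have e2 := (vfun_tendsto.div_const (ε ^ 2)).eventually_le_const
    (show 0 / ε ^ 2 < δ / 2 by rw [zero_div]; linarith)
  have e3 := ((tendsto_one_div_atTop_nhds_zero_nat (𝕜 := ℝ)).const_mul 4).eventually_le_const
    (show 4 * 0 < ε by rw [mul_zero]; exact hε)
  obtain ⟨n₀, hn₀⟩ := Filter.eventually_atTop.1
    (((e1.and e2).and e3).and (Filter.eventually_ge_atTop 3))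
  refine ⟨n₀, fun G _ _ hG => ?_⟩
  obtain ⟨⟨⟨h1, h2⟩, h3⟩, h4⟩ := hn₀ _ hG
  obtain ⟨hp0, hp1, _, _⟩ := pfun_facts _ h4
  have hpos : 0 < (Fintype.card G : ℝ) := by
    have : 0 < Fintype.card G := by omega
    exact_mod_cast this
  exact main_bound hp0 hp1 hε hε1 hεη hpos h3 h1 h2

end
end

section
/- For every η > 0 there exists a constant C > 0 with the following property. For every δ > 0 there exists n_0 such that for every Abelian group G of order n ≥ n_0, if U is a random subset of G with each element chosen independently with probability C n^{-2/3} (log n)^{1/3}, and μ is the characteristic measure of U, then with probability at least 1 − δ the following holds: for every finitely generated Abelian group H and every Freiman homomorphism φ : U → H, letting Γ' be the set of all 12-tuples (x_1, …, x_{12}) ∈ G^{12} with x_1 + ⋯ + x_6 = x_7 + ⋯ + x_{12}, and Φ the set of tuples in Γ' all of whose coordinates lie in U and which satisfy φ(x_1) + ⋯ + φ(x_6) = φ(x_7) + ⋯ + φ(x_{12}), one has E_{(x_1,…,x_{12}) ∈ Γ'} μ(x_1) ⋯ μ(x_{12}) 1_{(x_1,…,x_{12}) ∈ Φ} ≥ 1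 − 36η. -/
open scoped Classical
open Finset

noncomputable section

/-- `φ` is a Freiman homomorphism on `U`. -/
def FreimanHomOn {G H : Type*} [AddCommGroup G] [AddCommGroup H]
    (U : Finset G) (φ : G → H) : Prop :=
  ∀ a ∈ U, ∀ b ∈ U, ∀ c ∈ U, ∀ d ∈ U, a + b = c + d → φ a + φ b = φ c + φ d

/-- Additive 12-tuples, written as pairs of 6-tuples `(x₁,…,x₆)`, `(x₇,…,x₁₂)` with
`x₁ + ⋯ + x₆ = x₇ + ⋯ + x₁₂`. -/
def Gam12 (G : Type*) [AddCommGroup G] [Fintype G] :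
    Finset ((Fin 6 → G) × (Fin 6 → G)) :=
  Finset.univ.filter fun q => ∑ i, q.1 i = ∑ i, q.2 i


/-- Expectation over a Bernoulli random subset. -/
def Ex {G : Type} [Fintype G] (p : ℝ) (F : Finset G → ℝ) : ℝ :=
  ∑ A : Finset G, bernWeight p A * F A

/-- indicator of membership -/
def ind {G : Type} (A : Finset G) (x : G) : ℝ := if x ∈ A then 1 else 0

section prob
variable {G : Type} [Fintype G]

lemma bern_eq_prod (p : ℝ) (A : Finset G) :
    bernWeight p A = ∏ x, if x ∈ A then p else 1 - p := by
  rw [Finset.prod_ite]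
  simp only [Finset.prod_const, bernWeight]
  congr 2
  · congr 1; ext x; simp
  · rw [← Finset.card_compl]; congr 1; ext x; simp

lemma Ex_prod (p : ℝ) (u v : G → ℝ) :
    Ex p (fun A => ∏ x, if x ∈ A then u x else v x) = ∏ x, (p * u x + (1 - p) * v x) := by
  rw [Finset.prod_add]
  simp only [Ex, bern_eq_prod, ← Finset.prod_mul_distrib]
  rw [Finset.powerset_univ]
  refine Finset.sum_congr rfl fun A _ => ?_
  rw [← Finset.prod_sdiff (Finset.subset_univ A), mul_comm]
  congr 1
  · exact Finset.prod_congr rfl fun x hx => by simp [hx]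
  · exact Finset.prod_congr rfl fun x hx => by
      simp at hx; simp [hx]

lemma bern_nonneg {p : ℝ} (h0 : 0 ≤ p) (h1 : p ≤ 1) (A : Finset G) : 0 ≤ bernWeight p A :=
  mul_nonneg (pow_nonneg h0 _) (pow_nonneg (by linarith) _)

lemma Ex_mono {p : ℝ} (h0 : 0 ≤ p) (h1 : p ≤ 1) {F K : Finset G → ℝ} (h : ∀ A, F A ≤ K A) :
    Ex p F ≤ Ex p K :=
  Finset.sum_le_sum fun A _ => mul_le_mul_of_nonneg_left (h A) (bern_nonneg h0 h1 A)

lemma Ex_const (p c : ℝ) : Ex (G := G) p (fun _ => c) = c := by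
  have h := Ex_prod (G := G) p (fun _ => 1) (fun _ => 1)
  simp [Ex] at h
  simp [Ex, ← Finset.sum_mul, h]

lemma Ex_add (p : ℝ) (F K : Finset G → ℝ) : Ex p (fun A => F A + K A) = Ex p F + Ex p K := by
  simp [Ex, mul_add, Finset.sum_add_distrib]

lemma Ex_sub (p : ℝ) (F K : Finset G → ℝ) : Ex p (fun A => F A - K A) = Ex p F - Ex p K := by
  simp [Ex, mul_sub, Finset.sum_sub_distrib]

lemma Ex_mul_left (p c : ℝ) (F : Finset G → ℝ) : Ex p (fun A => c * F A) = c * Ex p F := by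
  simp only [Ex, Finset.mul_sum]
  exact Finset.sum_congr rfl fun _ _ => by ring

lemma Ex_mul_right (p c : ℝ) (F : Finset G → ℝ) : Ex p (fun A => F A * c) = Ex p F * c := by
  simp only [Ex, Finset.sum_mul]
  exact Finset.sum_congr rfl fun _ _ => by ring

lemma Ex_sum {ι : Type*} (p : ℝ) (s : Finset ι) (F : ι → Finset G → ℝ) :
    Ex p (fun A => ∑ i ∈ s, F i A) = ∑ i ∈ s, Ex p (F i) := by
  simp only [Ex, Finset.mul_sum]
  exact Finset.sum_comm

lemma Ex_comm (p q : ℝ) (F : Finset G → Finset G → ℝ) :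
    Ex p (fun A => Ex q (fun B => F A B)) = Ex q (fun B => Ex p (fun A => F A B)) := by
  simp only [Ex, Finset.mul_sum]
  rw [Finset.sum_comm]
  exact Finset.sum_congr rfl fun _ _ => Finset.sum_congr rfl fun _ _ => by ring

lemma Ex_nonneg {p : ℝ} (h0 : 0 ≤ p) (h1 : p ≤ 1) {F : Finset G → ℝ} (h : ∀ A, 0 ≤ F A) :
    0 ≤ Ex p F := Finset.sum_nonneg fun A _ => mul_nonneg (bern_nonneg h0 h1 A) (h A)

lemma Ex_le_const {p : ℝ} (h0 : 0 ≤ p) (h1 : p ≤ 1) {F : Finset G → ℝ} {c : ℝ}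
    (h : ∀ A, F A ≤ c) : Ex p F ≤ c :=
  (Ex_mono h0 h1 h).trans (Ex_const p c).le

lemma Ex_point (p : ℝ) (U : Finset G) :
    Ex p (fun A => if A = U then (1 : ℝ) else 0) = bernWeight p U := by
  simp [Ex]

lemma Ex_union_point (p q : ℝ) (U : Finset G) :
    Ex p (fun A => Ex q (fun B => if A ∪ B = U then (1 : ℝ) else 0))
      = bernWeight (p + q - p * q) U := by
  have h1 : ∀ A B : Finset G, (if A ∪ B = U then (1 : ℝ) else 0)
      = ∏ x, if x ∈ B then (if x ∈ U then (1 : ℝ) else 0)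
          else (if (x ∈ A ↔ x ∈ U) then 1 else 0) := by
    intro A B
    split_ifs with h
    · symm
      apply Finset.prod_eq_one
      intro x _
      subst h
      by_cases hB : x ∈ B <;> simp [hB]
    · symm
      have : ∃ x, ¬ (x ∈ A ∪ B ↔ x ∈ U) := by
        by_contra hc; push Not at hc; exact h (Finset.ext hc)
      obtain ⟨x, hx⟩ := this
      apply Finset.prod_eq_zero (Finset.mem_univ x)
      by_cases hB : x ∈ B
      · simp [hB] at hx ⊢; exact hx
      · simp [hB] at hx ⊢; tauto
  simp only [h1, Ex_prod]
  have h2 : ∀ A : Finset G, (∏ x, (q * (if x ∈ U then (1 : ℝ) else 0)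
      + (1 - q) * (if (x ∈ A ↔ x ∈ U) then 1 else 0)))
      = ∏ x, if x ∈ A then (if x ∈ U then (1 : ℝ) else 0) else
        (q * (if x ∈ U then (1 : ℝ) else 0) + (1 - q) * (if x ∈ U then (0 : ℝ) else 1)) := by
    intro A
    refine Finset.prod_congr rfl fun x _ => ?_
    by_cases hA : x ∈ A <;> by_cases hU : x ∈ U <;> simp [hA, hU]
  simp only [h2, Ex_prod, bern_eq_prod]
  refine Finset.prod_congr rfl fun x _ => ?_
  by_cases hU : x ∈ U <;> simp [hU] <;> ring

lemma Ex_union (p q : ℝ) (F : Finset G → ℝ) :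
    Ex p (fun A => Ex q (fun B => F (A ∪ B))) = Ex (p + q - p * q) F := by
  have h : ∀ W : Finset G, F W = ∑ U : Finset G, (if W = U then (1 : ℝ) else 0) * F U := by
    intro W; simp
  have h2 : (fun A => Ex q (fun B => F (A ∪ B))) =
     fun A => ∑ U : Finset G, Ex q (fun B => (if A ∪ B = U then (1 : ℝ) else 0)) * F U := by
    funext A
    simp_rw [← Ex_mul_right, ← Ex_sum]
    congr 1; funext B; exact h _
  rw [h2, Ex_sum]
  simp only [Ex_mul_right, Ex_union_point]
  rfl

lemma Ex_ind2 (p : ℝ) (a b : G) :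
    Ex p (fun A => ind A a * ind A b) = if a = b then p else p ^ 2 := by
  have h1 : ∀ A : Finset G, ind A a * ind A b
      = ∏ x, if x ∈ A then (1 : ℝ) else (if x ∈ ({a, b} : Finset G) then 0 else 1) := by
    intro A
    have : ∀ x, (if x ∈ A then (1 : ℝ) else (if x ∈ ({a, b} : Finset G) then 0 else 1))
       = if x ∈ ({a, b} : Finset G) then (if x ∈ A then 1 else 0) else 1 := by
      intro x; by_cases hx : x ∈ A <;> simp [hx]
    simp_rw [this, Finset.prod_ite_mem, Finset.univ_inter]
    by_cases hab : a = b
    · subst hab; simp [ind]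
    · rw [Finset.prod_pair hab]; rfl
  simp_rw [h1, Ex_prod]
  have : ∀ x, (p * 1 + (1 - p) * (if x ∈ ({a, b} : Finset G) then 0 else 1))
       = if x ∈ ({a, b} : Finset G) then p else 1 := by
    intro x; split_ifs <;> ring
  simp_rw [this, Finset.prod_ite_mem, Finset.univ_inter]
  by_cases hab : a = b
  · subst hab; simp
  · rw [Finset.prod_pair hab]; simp [hab, sq]

lemma Ex_ind (p : ℝ) (a : G) : Ex p (fun A => ind A a) = p := by
  have := Ex_ind2 p a a
  simp only [if_true] at this
  rw [← this]
  congr 1; funext A; simp [ind]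

lemma Ex_card (p : ℝ) : Ex p (fun A : Finset G => (A.card : ℝ)) = p * Fintype.card G := by
  have : ∀ A : Finset G, (A.card : ℝ) = ∑ x, ind A x := by intro A; simp [ind]
  simp_rw [this, Ex_sum, Ex_ind]; simp [mul_comm]

lemma chernoff {p : ℝ} (h0 : 0 ≤ p) (h1 : p ≤ 1) (w : G → ℝ) (hw0 : ∀ x, 0 ≤ w x)
    (hw1 : ∀ x, w x ≤ 1) (S : ℝ) (hS : S ≤ ∑ x, w x) :
    Ex p (fun A => if ∑ x ∈ A, w x ≤ p * S / 4 then (1 : ℝ) else 0)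
      ≤ Real.exp (-(p * S / 4)) := by
  have hb : ∀ x, p * Real.exp (-w x) + (1 - p) * 1 ≤ Real.exp (-(p * w x / 2)) := by
    intro x
    have hconv : Real.exp (-w x) ≤ 1 - w x / 2 := by
      have h3 := Real.exp_bound' (x := w x) (hw0 x) (hw1 x) (n := 2) (by norm_num)
      have h4 : 1 + w x + w x ^ 2 / 2 ≤ Real.exp (w x) := Real.quadratic_le_exp_of_nonneg (hw0 x)
      rw [Real.exp_neg]
      have : (Real.exp (w x))⁻¹ ≤ (1 + w x + w x ^ 2 / 2)⁻¹ := by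
        apply inv_anti₀ _ h4; have := hw0 x; positivity
      refine this.trans ?_
      rw [inv_le_iff_one_le_mul₀ (by have := hw0 x; positivity)]
      have a := hw0 x; have b := hw1 x
      have c : w x ^ 2 * w x ≤ w x ^ 2 * 1 := by gcongr
      have d : w x * w x ≤ w x * 1 := by gcongr
      nlinarith
    have := Real.add_one_le_exp (-(p * w x / 2))
    nlinarith
  calc Ex p (fun A => if ∑ x ∈ A, w x ≤ p * S / 4 then (1 : ℝ) else 0)
      ≤ Ex p (fun A => Real.exp (p * S / 4) * ∏ x, if x ∈ A then Real.exp (-w x) else 1) := by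
        apply Ex_mono h0 h1
        intro A
        have : (∏ x, if x ∈ A then Real.exp (-w x) else 1) = Real.exp (-∑ x ∈ A, w x) := by
          rw [Finset.prod_ite_mem, Finset.univ_inter, ← Real.exp_sum, Finset.sum_neg_distrib]
        rw [this, ← Real.exp_add]
        split_ifs with h
        · apply Real.one_le_exp; linarith
        · positivity
    _ = Real.exp (p * S / 4) * ∏ x, (p * Real.exp (-w x) + (1 - p) * 1) := by
        rw [Ex_mul_left, Ex_prod]
    _ ≤ Real.exp (p * S / 4) * ∏ x, Real.exp (-(p * w x / 2)) := by
        refine mul_le_mul_of_nonneg_left (Finset.prod_le_prod ?_ fun x _ => hb x)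
          (Real.exp_pos _).le
        intro x _; have := Real.exp_pos (-w x); nlinarith [mul_nonneg h0 this.le]
    _ = Real.exp (p * S / 4 - p * (∑ x, w x) / 2) := by
        rw [← Real.exp_sum, ← Real.exp_add]
        congr 1
        rw [Finset.sum_neg_distrib, ← Finset.sum_div, ← Finset.mul_sum]; ring
    _ ≤ Real.exp (-(p * S / 4)) := by
        apply Real.exp_le_exp.mpr
        nlinarith

end prob

section second
set_option linter.unusedSectionVars false
set_option linter.unusedVariables false
variable {G : Type} [AddCommGroup G] [Fintype G]

/-- number of representations `d = a + b - c` -/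
def rep (A B C : Finset G) (d : G) : ℝ := ∑ a, ∑ b, ind A a * ind B b * ind C (a + b - d)

lemma ind_nonneg (A : Finset G) (x : G) : 0 ≤ ind A x := by unfold ind; split_ifs <;> norm_num
lemma ind_le_one (A : Finset G) (x : G) : ind A x ≤ 1 := by unfold ind; split_ifs <;> norm_num

lemma rep_nonneg (A B C : Finset G) (d : G) : 0 ≤ rep A B C d :=
  Finset.sum_nonneg fun a _ => Finset.sum_nonneg fun b _ =>
    mul_nonneg (mul_nonneg (ind_nonneg _ _) (ind_nonneg _ _)) (ind_nonneg _ _)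

lemma sum_ite_mem_univ' {M : Type*} [AddCommMonoid M] (A : Finset G) (f : G → M) :
    (∑ x, if x ∈ A then f x else 0) = ∑ x ∈ A, f x := by
  simp

lemma Ex_rep (q1 q2 q3 : ℝ) (d : G) :
    Ex q1 (fun A => Ex q2 (fun B => Ex q3 (fun C => rep A B C d)))
      = (Fintype.card G : ℝ) ^ 2 * (q1 * q2 * q3) := by
  simp only [rep, Ex_sum, Ex_mul_left, Ex_mul_right, Ex_ind]
  simp; ring

lemma Ex_rep_sq_le {q1 q2 q3 : ℝ} (h1 : 0 ≤ q1) (h2 : 0 ≤ q2) (h3 : 0 ≤ q3) (d : G) :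
    Ex q1 (fun A => Ex q2 (fun B => Ex q3 (fun C => rep A B C d ^ 2)))
      ≤ (Fintype.card G : ℝ) ^ 2 *
        (((Fintype.card G : ℝ) * q1 ^ 2 + q1) *
          ((Fintype.card G : ℝ) * q2 ^ 2 * q3 ^ 2 + q2 ^ 2 * q3 + q2 * q3 ^ 2)
          + (q1 ^ 2 + q1) * (q2 * q3)) := by
  have hsq : ∀ A B C : Finset G, rep A B C d ^ 2 = ∑ a, ∑ b, ∑ a', ∑ b',
      (ind A a * ind A a') * (ind B b * ind B b') *
        (ind C (a + b - d) * ind C (a' + b' - d)) := by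
    intro A B C
    rw [sq, rep, Finset.sum_mul]
    refine Finset.sum_congr rfl fun a _ => ?_
    rw [Finset.sum_mul]
    refine Finset.sum_congr rfl fun b _ => ?_
    rw [Finset.mul_sum]
    refine Finset.sum_congr rfl fun a' _ => ?_
    rw [Finset.mul_sum]
    refine Finset.sum_congr rfl fun b' _ => ?_
    ring
  simp only [hsq, Ex_sum, Ex_mul_left, Ex_mul_right, Ex_ind2]
  have hm : ∀ q : ℝ, 0 ≤ q → ∀ P : Prop, (if P then q else q ^ 2) ≤ q ^ 2 + (if P then q else 0) := by
    intro q hq P; split_ifs <;> nlinarith [sq_nonneg q]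
  have hm0 : ∀ q : ℝ, 0 ≤ q → ∀ P : Prop, 0 ≤ (if P then q else q ^ 2) := by
    intro q hq P; split_ifs <;> positivity
  set n : ℝ := (Fintype.card G : ℝ) with hn
  have hb : ∀ a b a' : G, (∑ b', (q2 ^ 2 + (if b = b' then q2 else 0)) *
      (q3 ^ 2 + (if a + b - d = a' + b' - d then q3 else 0)))
      = (n * q2 ^ 2 * q3 ^ 2 + q2 ^ 2 * q3 + q2 * q3 ^ 2) + (if a = a' then q2 * q3 else 0) := by
    intro a b a'
    have e : ∀ b', (a + b - d = a' + b' - d) ↔ (a + b - a' = b') := by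
      intro b'; constructor <;> intro h
      · rw [sub_left_inj] at h; rw [h]; abel
      · rw [← h]; abel
    simp only [e, add_mul, mul_add, Finset.sum_add_distrib, mul_ite, ite_mul, mul_zero, zero_mul]
    simp
    have e2 : (b = a + b - a') ↔ a = a' := by
      constructor <;> intro h
      · have : b + a' = a + b := eq_sub_iff_add_eq.mp h
        rw [add_comm] at this; exact (add_right_cancel this).symm
      · rw [h]; abel
    simp only [e2]
    split_ifs <;> ring
  have ha : ∀ a : G, (∑ a', (q1 ^ 2 + (if a = a' then q1 else 0)) *
      ((n * q2 ^ 2 * q3 ^ 2 + q2 ^ 2 * q3 + q2 * q3 ^ 2) + (if a = a' then q2 * q3 else 0)))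
      = (n * q1 ^ 2 + q1) * (n * q2 ^ 2 * q3 ^ 2 + q2 ^ 2 * q3 + q2 * q3 ^ 2)
          + (q1 ^ 2 + q1) * (q2 * q3) := by
    intro a
    generalize (n * q2 ^ 2 * q3 ^ 2 + q2 ^ 2 * q3 + q2 * q3 ^ 2) = K
    simp only [add_mul, mul_add, Finset.sum_add_distrib, mul_ite, ite_mul, mul_zero, zero_mul]
    simp [← hn]
    ring
  calc _ ≤ ∑ a : G, ∑ b : G, ∑ a', ∑ b', (q1 ^ 2 + (if a = a' then q1 else 0)) *
        ((q2 ^ 2 + (if b = b' then q2 else 0)) *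
      (q3 ^ 2 + (if a + b - d = a' + b' - d then q3 else 0))) := by
        refine Finset.sum_le_sum fun a _ => Finset.sum_le_sum fun b _ =>
          Finset.sum_le_sum fun a' _ => Finset.sum_le_sum fun b' _ => ?_
        rw [mul_assoc]
        refine mul_le_mul (hm _ h1 _) (mul_le_mul (hm _ h2 _) (hm _ h3 _) (hm0 _ h3 _)
          ((hm0 _ h2 _).trans (hm _ h2 _))) (mul_nonneg (hm0 _ h2 _) (hm0 _ h3 _))
          ((hm0 _ h1 _).trans (hm _ h1 _))
    _ = _ := by
        simp only [← Finset.mul_sum, hb, ha]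
        simp [← hn]; ring

lemma Ex_rep_sq_le' {q q1 q2 q3 : ℝ} (hq : 0 < q) (h1 : q ≤ q1) (h2 : q ≤ q2) (h3 : q ≤ q3)
    (h1' : q1 ≤ 1) (h2' : q2 ≤ 1) (h3' : q3 ≤ 1) (d : G) :
    Ex q1 (fun A => Ex q2 (fun B => Ex q3 (fun C => rep A B C d ^ 2)))
      ≤ ((Fintype.card G : ℝ) ^ 2 * (q1 * q2 * q3)) ^ 2 *
        (1 + 3 / (q * Fintype.card G) + 4 / (q ^ 3 * (Fintype.card G : ℝ) ^ 2)) := by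
  have p1 := hq.trans_le h1
  have p2 := hq.trans_le h2
  have p3 := hq.trans_le h3
  refine (Ex_rep_sq_le p1.le p2.le p3.le d).trans ?_
  set n : ℝ := (Fintype.card G : ℝ) with hn
  have hn0 : 0 < n := by rw [hn]; exact_mod_cast Fintype.card_pos
  set Q := q1 * q2 * q3 with hQ
  have hQ0 : 0 < Q := by positivity
  have key1 : ∀ x : ℝ, q ≤ x → n ^ 3 * (Q ^ 2 / x) ≤ (n ^ 2 * Q) ^ 2 * (1 / (q * n)) := by
    intro x hx
    have : Q ^ 2 / x ≤ Q ^ 2 / q := by gcongr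
    calc n ^ 3 * (Q ^ 2 / x) ≤ n ^ 3 * (Q ^ 2 / q) := by gcongr
      _ = _ := by field_simp
  have key2 : ∀ x : ℝ, 0 ≤ x → x ≤ 1 → n ^ 2 * (Q * x) ≤ (n ^ 2 * Q) ^ 2 * (1 / (q ^ 3 * n ^ 2)) := by
    intro x hx0 hx
    have hq3 : q ^ 3 ≤ Q := by
      calc q ^ 3 = q * q * q := by ring
        _ ≤ Q := by rw [hQ]; gcongr
    calc n ^ 2 * (Q * x) ≤ n ^ 2 * (Q * 1) := by gcongr
      _ = n ^ 2 * (Q ^ 2 / Q) := by field_simp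
      _ ≤ n ^ 2 * (Q ^ 2 / q ^ 3) := by gcongr
      _ = _ := by field_simp
  have a1 := key1 q1 h1
  have a2 := key1 q2 h2
  have a3 := key1 q3 h3
  have e1 : Q ^ 2 / q1 = q1 * q2 ^ 2 * q3 ^ 2 := by rw [hQ]; field_simp
  have e2 : Q ^ 2 / q2 = q1 ^ 2 * q2 * q3 ^ 2 := by rw [hQ]; field_simp
  have e3 : Q ^ 2 / q3 = q1 ^ 2 * q2 ^ 2 * q3 := by rw [hQ]; field_simp
  rw [e1] at a1; rw [e2] at a2; rw [e3] at a3
  have b1 := key2 q1 p1.le h1'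
  have b2 := key2 q2 p2.le h2'
  have b3 := key2 q3 p3.le h3'
  have b4 := key2 1 zero_le_one le_rfl
  have e : (n ^ 2 * Q) ^ 2 * (1 + 3 / (q * n) + 4 / (q ^ 3 * n ^ 2))
     = (n ^ 2 * Q) ^ 2 + 3 * ((n ^ 2 * Q) ^ 2 * (1 / (q * n)))
       + 4 * ((n ^ 2 * Q) ^ 2 * (1 / (q ^ 3 * n ^ 2))) := by ring
  rw [e]
  generalize (n ^ 2 * Q) ^ 2 * (1 / (q * n)) = Y at *
  generalize (n ^ 2 * Q) ^ 2 * (1 / (q ^ 3 * n ^ 2)) = Z at *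
  rw [hQ] at b1 b2 b3 b4 ⊢
  nlinarith

/-- expected number of non-represented elements -/
lemma Ex_unrep {q : ℝ} (hq : 0 < q) (hq1 : q ≤ 1) :
    Ex q (fun A => Ex q (fun B => Ex q (fun C : Finset G =>
      ∑ d, if rep A B C d = 0 then (1 : ℝ) else 0)))
      ≤ Fintype.card G * (3 / (q * Fintype.card G) + 4 / (q ^ 3 * (Fintype.card G : ℝ) ^ 2)) := by
  simp only [Ex_sum]
  set n : ℝ := (Fintype.card G : ℝ) with hn
  have hn0 : 0 < n := by rw [hn]; exact_mod_cast Fintype.card_pos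
  set m := n ^ 2 * (q * q * q) with hm
  have hm0 : 0 < m := by positivity
  have key : ∀ d : G, Ex q (fun A => Ex q (fun B => Ex q (fun C : Finset G =>
      if rep A B C d = 0 then (1 : ℝ) else 0)))
      ≤ 3 / (q * n) + 4 / (q ^ 3 * n ^ 2) := by
    intro d
    have h1 : m ^ 2 * Ex q (fun A => Ex q (fun B => Ex q (fun C : Finset G =>
      if rep A B C d = 0 then (1 : ℝ) else 0))) ≤
      Ex q (fun A => Ex q (fun B => Ex q (fun C : Finset G =>
        rep A B C d ^ 2 - 2 * m * rep A B C d + m ^ 2))) := by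
      simp only [← Ex_mul_left]
      refine Ex_mono hq.le hq1 fun A => Ex_mono hq.le hq1 fun B => Ex_mono hq.le hq1 fun C => ?_
      split_ifs with h
      · rw [h]; nlinarith
      · nlinarith [sq_nonneg (rep A B C d - m)]
    simp only [Ex_add, Ex_sub, Ex_mul_left, Ex_const, Ex_rep] at h1
    have h2 := Ex_rep_sq_le' (G := G) hq le_rfl le_rfl le_rfl hq1 hq1 hq1 d
    rw [← hn, ← hm] at h1 h2
    refine le_of_mul_le_mul_left ?_ (pow_pos hm0 2)
    nlinarith
  calc _ ≤ ∑ _d : G, (3 / (q * n) + 4 / (q ^ 3 * n ^ 2)) := Finset.sum_le_sum fun d _ => key d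
    _ = _ := by simp [← hn]; ring

/-- Two-round exposure. -/
lemma two_round {p ε X ν : ℝ} (hp : 0 < p) (hp1 : p ≤ 1) (D A : Finset G)
    (Inc : G → G → G → Prop) (hX : 0 < X) (hν0 : 0 ≤ ν) (hε : 0 < ε)
    (hD : 0 < D.card) (hA : 0 < A.card)
    (hν : ν * X ≤ (p * (ε * Fintype.card G) / 4 * (D.card * A.card)) ^ 2)
    (hI : ε * Fintype.card G * (D.card * A.card) ≤
      ∑ x ∈ D, ∑ b ∈ A, ∑ c, if Inc x b c then (1 : ℝ) else 0) :
    Ex p (fun E => Ex p (fun F => if (∑ d, rep D A E d ^ 2 ≤ X ∧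
      ∀ x ∈ D, ∀ b ∈ A, ∀ c ∈ E, Inc x b c → x + b - c ∉ F) then (1 : ℝ) else 0))
      ≤ Real.exp (-(p * (ε * Fintype.card G) / 4)) + Real.exp (-(p * ν / 4)) := by
  set n : ℝ := (Fintype.card G : ℝ) with hn
  set m : ℝ := (D.card * A.card : ℝ) with hm
  have hm0 : 0 < m := by rw [hm]; positivity
  set w : G → ℝ := fun c => (∑ x ∈ D, ∑ b ∈ A, if Inc x b c then (1 : ℝ) else 0) / m with hw
  have hw0 : ∀ c, 0 ≤ w c := fun c => div_nonneg (Finset.sum_nonneg fun _ _ =>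
    Finset.sum_nonneg fun _ _ => by split_ifs <;> norm_num) hm0.le
  have hw1 : ∀ c, w c ≤ 1 := by
    intro c
    rw [hw]
    simp only
    rw [div_le_one hm0]
    calc _ ≤ ∑ x ∈ D, ∑ b ∈ A, (1 : ℝ) := Finset.sum_le_sum fun _ _ =>
          Finset.sum_le_sum fun _ _ => by split_ifs <;> norm_num
      _ = m := by simp [hm]
  have hsum : ε * n ≤ ∑ c, w c := by
    simp only [hw]
    rw [← Finset.sum_div, le_div_iff₀ hm0]
    refine hI.trans (le_of_eq ?_)
    symm
    rw [Finset.sum_comm]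
    refine Finset.sum_congr rfl fun x _ => ?_
    rw [Finset.sum_comm]
  have ch := chernoff hp.le hp1 w hw0 hw1 (ε * n) hsum
  have step : ∀ E : Finset G, Ex p (fun F => if (∑ d, rep D A E d ^ 2 ≤ X ∧
      ∀ x ∈ D, ∀ b ∈ A, ∀ c ∈ E, Inc x b c → x + b - c ∉ F) then (1 : ℝ) else 0)
      ≤ (if ∑ c ∈ E, w c ≤ p * (ε * n) / 4 then (1 : ℝ) else 0) + Real.exp (-(p * ν / 4)) := by
    intro E
    split_ifs with hE
    · refine (Ex_le_const (c := 1) hp.le hp1 fun F => ?_).trans ?_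
      · split_ifs <;> norm_num
      · linarith [Real.exp_pos (-(p * ν / 4))]
    · rw [zero_add]
      by_cases hr : ∑ d, rep D A E d ^ 2 ≤ X
      swap
      · refine (Ex_le_const (c := 0) hp.le hp1 fun F => ?_).trans (Real.exp_pos _).le
        simp [hr]
      set N : Finset G := Finset.univ.filter
        (fun d => ∃ x ∈ D, ∃ b ∈ A, x + b - d ∈ E ∧ Inc x b (x + b - d)) with hN
      have hcount : p * (ε * n) / 4 * m ≤ ∑ d ∈ N, rep D A E d := by
        push Not at hE
        have e1 : ∑ c ∈ E, w c = (∑ c ∈ E, ∑ x ∈ D, ∑ b ∈ A,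
          if Inc x b c then (1 : ℝ) else 0) / m := by
          simp only [hw]; rw [Finset.sum_div]
        rw [e1, lt_div_iff₀ hm0] at hE
        refine hE.le.trans ?_
        calc (∑ c ∈ E, ∑ x ∈ D, ∑ b ∈ A, if Inc x b c then (1 : ℝ) else 0)
            = ∑ x, ∑ b, ∑ c, ind D x * ind A b * ind E c * (if Inc x b c then (1 : ℝ) else 0) := by
              simp only [ind]
              rw [Finset.sum_comm, ← sum_ite_mem_univ']
              refine Finset.sum_congr rfl fun x _ => ?_
              rw [Finset.sum_comm, ← sum_ite_mem_univ']
              by_cases hx : x ∈ D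
              · rw [if_pos hx]
                refine Finset.sum_congr rfl fun b _ => ?_
                by_cases hb : b ∈ A
                · rw [if_pos hb, ← sum_ite_mem_univ']
                  refine Finset.sum_congr rfl fun c _ => ?_
                  by_cases hc : c ∈ E <;> simp [hx, hb, hc]
                · simp [hb]
              · simp [hx]
          _ = ∑ x, ∑ b, ∑ d, ind D x * ind A b * ind E (x + b - d) *
              (if Inc x b (x + b - d) then (1 : ℝ) else 0) := by
              refine Finset.sum_congr rfl fun x _ => Finset.sum_congr rfl fun b _ => ?_
              exact (Equiv.sum_comp (Equiv.subLeft (x + b)) (fun c => ind D x * ind A b * ind E c *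
                (if Inc x b c then (1 : ℝ) else 0))).symm
          _ = ∑ d, ∑ x, ∑ b, ind D x * ind A b * ind E (x + b - d) *
              (if Inc x b (x + b - d) then (1 : ℝ) else 0) := by
              rw [Finset.sum_comm]
              rw [Finset.sum_congr rfl fun b _ => Finset.sum_comm, Finset.sum_comm]
              exact Finset.sum_congr rfl fun d _ => Finset.sum_comm
          _ ≤ ∑ d, if d ∈ N then rep D A E d else 0 := by
              refine Finset.sum_le_sum fun d _ => ?_
              split_ifs with hd
              · rw [rep]
                refine Finset.sum_le_sum fun x _ => Finset.sum_le_sum fun b _ => ?_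
                have := mul_nonneg (mul_nonneg (ind_nonneg D x) (ind_nonneg A b))
                  (ind_nonneg E (x + b - d))
                split_ifs <;> linarith
              · apply le_of_eq
                refine Finset.sum_eq_zero fun x _ => Finset.sum_eq_zero fun b _ => ?_
                by_contra hne
                apply hd
                simp only [hN, Finset.mem_filter, Finset.mem_univ, true_and]
                simp [ind] at hne
                exact ⟨x, by tauto, b, by tauto, by tauto, by tauto⟩
          _ = ∑ d ∈ N, rep D A E d := by simp
      have hcs : (∑ d ∈ N, rep D A E d) ^ 2 ≤ N.card * X := by
        refine (sq_sum_le_card_mul_sum_sq).trans ?_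
        refine mul_le_mul_of_nonneg_left ((Finset.sum_le_sum_of_subset_of_nonneg
          (Finset.subset_univ N) fun _ _ _ => sq_nonneg _).trans hr) (Nat.cast_nonneg _)
      have hNν : ν ≤ N.card := by
        refine le_of_mul_le_mul_right (hν.trans (le_trans ?_ hcs)) hX
        have : 0 ≤ p * (ε * n) / 4 * m := by rw [hn]; positivity
        gcongr
      have ch2 := chernoff hp.le hp1 (fun d => ind N d) (ind_nonneg N) (ind_le_one N) ν
        (by simpa [ind] using hNν)
      refine le_trans (Ex_mono hp.le hp1 fun F => ?_) ch2
      split_ifs with h1 h2 h2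
      · exact le_rfl
      · exfalso
        apply h2
        have : ∑ x ∈ F, ind N x = 0 := by
          refine Finset.sum_eq_zero fun d hd => ?_
          rw [ind, if_neg]
          intro hdN
          simp only [hN, Finset.mem_filter, Finset.mem_univ, true_and] at hdN
          obtain ⟨x, hx, b, hb, hE', hInc⟩ := hdN
          have := h1.2 x hx b hb _ hE' hInc
          rw [sub_sub_cancel] at this
          exact this hd
        rw [this]
        positivity
      · norm_num
      · norm_num
  calc _ ≤ Ex p (fun E => (if ∑ c ∈ E, w c ≤ p * (ε * n) / 4 then (1 : ℝ) else 0)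
        + Real.exp (-(p * ν / 4))) := Ex_mono hp.le hp1 step
    _ ≤ _ := by rw [Ex_add, Ex_const]; linarith

end second

section fourier
variable {G : Type} [AddCommGroup G] [Fintype G]

open ComplexConjugate

lemma addChar_sum {H ι : Type*} [AddCommGroup H] (ψ : AddChar H ℂ) (s : Finset ι) (f : ι → H) :
    ψ (∑ i ∈ s, f i) = ∏ i ∈ s, ψ (f i) := by
  induction s using Finset.induction_on with
  | empty => simp
  | insert a s ha ih => rw [Finset.sum_insert ha, Finset.prod_insert ha, AddChar.map_add_eq_mul, ih]

lemma conj_char (γ : AddChar G ℂ) (x : G) : conj (γ x) = γ (-x) := by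
  rw [AddChar.map_neg_eq_conj]

lemma parseval (h : G → ℂ) :
    ∑ γ : AddChar G ℂ, ‖∑ x, h x * γ x‖ ^ 2 = Fintype.card G * ∑ x, ‖h x‖ ^ 2 := by
  have : ((∑ γ : AddChar G ℂ, ‖∑ x, h x * γ x‖ ^ 2 : ℝ) : ℂ)
      = ((Fintype.card G * ∑ x, ‖h x‖ ^ 2 : ℝ) : ℂ) := by
    push_cast
    simp_rw [← Complex.mul_conj']
    have e : ∀ γ : AddChar G ℂ, (∑ x, h x * γ x) * conj (∑ x, h x * γ x)
        = ∑ x, ∑ y, h x * conj (h y) * γ (x - y) := by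
      intro γ
      rw [map_sum, Finset.sum_mul_sum]
      refine Finset.sum_congr rfl fun x _ => Finset.sum_congr rfl fun y _ => ?_
      rw [map_mul, conj_char, sub_eq_add_neg, AddChar.map_add_eq_mul]; ring
    simp_rw [e]
    rw [Finset.sum_comm, Finset.mul_sum]
    refine Finset.sum_congr rfl fun x _ => ?_
    rw [Finset.sum_comm]
    simp_rw [← Finset.mul_sum, AddChar.sum_apply_eq_ite, sub_eq_zero]
    simp
    ring
  exact_mod_cast this

lemma fourier_dense (D A : Finset G) (f g : G → ℂ) (hf : ∀ x, ‖f x‖ = 1) (hg : ∀ x, ‖g x‖ = 1)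
    {κ ε : ℝ} (hκ : 0 ≤ κ) (hA : 0 < A.card)
    (h : ∑ x ∈ D, ∑ b ∈ A, ∑ c, (if κ < ‖f x * f b - g c * g (x + b - c)‖ then (1 : ℝ) else 0)
      ≤ ε * Fintype.card G * (D.card * A.card)) :
    ∃ γ : AddChar G ℂ, (1 - κ - 2 * ε) * D.card ≤ ‖∑ x ∈ D, f x * γ x‖ := by
  obtain ⟨γ₀, -, hγ₀⟩ := Finset.exists_max_image (Finset.univ : Finset (AddChar G ℂ))
    (fun γ => ‖∑ x ∈ D, f x * γ x‖) ⟨0, Finset.mem_univ _⟩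
  refine ⟨γ₀, ?_⟩
  set n : ℝ := (Fintype.card G : ℝ) with hn
  have hn0 : 0 < n := by rw [hn]; exact_mod_cast Fintype.card_pos
  have hA0 : (0 : ℝ) < A.card := by exact_mod_cast hA
  set T : ℂ := ∑ x ∈ D, ∑ b ∈ A, ∑ c, f x * f b * conj (g c * g (x + b - c)) with hT
  have hre : (1 - κ - 2 * ε) * D.card * (A.card * n) ≤ T.re := by
    have hterm : ∀ x b c, 1 - κ - 2 * (if κ < ‖f x * f b - g c * g (x + b - c)‖ then (1 : ℝ) else 0)
        ≤ (f x * f b * conj (g c * g (x + b - c))).re := by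
      intro x b c
      set u := f x * f b with hu
      set v := g c * g (x + b - c) with hv
      have hu1 : ‖u‖ = 1 := by simp [hu, hf]
      have hv1 : ‖v‖ = 1 := by simp [hv, hg]
      split_ifs with hk
      · have h1 := Complex.abs_re_le_norm (u * conj v)
        have h2 : ‖u * conj v‖ = 1 := by simp [hu1, hv1]
        rw [h2] at h1
        linarith [neg_abs_le (u * conj v).re]
      · push Not at hk
        have h1 : u * conj v = 1 + (u - v) * conj v := by
          have : v * conj v = 1 := by rw [Complex.mul_conj']; simp [hv1]
          rw [sub_mul, this]; ring
        rw [h1, Complex.add_re, Complex.one_re]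
        have h2 := Complex.abs_re_le_norm ((u - v) * conj v)
        have h3 : ‖(u - v) * conj v‖ ≤ κ := by simpa [hv1] using hk
        linarith [neg_abs_le ((u - v) * conj v).re]
    calc (1 - κ - 2 * ε) * D.card * (A.card * n)
        = (1 - κ) * (n * (D.card * A.card)) - 2 * (ε * n * (D.card * A.card)) := by ring
      _ ≤ (1 - κ) * (n * (D.card * A.card)) - 2 * (∑ x ∈ D, ∑ b ∈ A, ∑ c,
          (if κ < ‖f x * f b - g c * g (x + b - c)‖ then (1 : ℝ) else 0)) := by linarith
      _ = ∑ x ∈ D, ∑ b ∈ A, ∑ c, (1 - κ - 2 *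
          (if κ < ‖f x * f b - g c * g (x + b - c)‖ then (1 : ℝ) else 0)) := by
          simp only [Finset.sum_sub_distrib, ← Finset.mul_sum, Finset.sum_const, nsmul_eq_mul,
            Finset.card_univ, ← hn]
          ring
      _ ≤ ∑ x ∈ D, ∑ b ∈ A, ∑ c, (f x * f b * conj (g c * g (x + b - c))).re :=
          Finset.sum_le_sum fun x _ => Finset.sum_le_sum fun b _ =>
            Finset.sum_le_sum fun c _ => hterm x b c
      _ = T.re := by simp only [hT, Complex.re_sum]
  have hfour : (n : ℂ) * T = ∑ γ : AddChar G ℂ, (∑ x ∈ D, f x * γ x) * (∑ b ∈ A, f b * γ b) *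
      (conj (∑ c, g c * γ c)) ^ 2 := by
    have e : ∀ γ : AddChar G ℂ, (∑ x ∈ D, f x * γ x) * (∑ b ∈ A, f b * γ b) *
      (conj (∑ c, g c * γ c)) ^ 2 = ∑ x ∈ D, ∑ b ∈ A, ∑ c, ∑ d,
        f x * f b * conj (g c) * conj (g d) * γ ((x + b - c) - d) := by
      intro γ
      rw [Finset.sum_mul_sum, map_sum (starRingEnd ℂ), sq, Finset.sum_mul_sum, Finset.sum_mul]
      refine Finset.sum_congr rfl fun x _ => ?_
      rw [Finset.sum_mul]
      refine Finset.sum_congr rfl fun b _ => ?_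
      rw [Finset.mul_sum]
      refine Finset.sum_congr rfl fun c _ => ?_
      rw [Finset.mul_sum]
      refine Finset.sum_congr rfl fun d _ => ?_
      rw [map_mul (starRingEnd ℂ), map_mul (starRingEnd ℂ), conj_char, conj_char, sub_eq_add_neg, sub_eq_add_neg,
        AddChar.map_add_eq_mul, AddChar.map_add_eq_mul, AddChar.map_add_eq_mul]
      ring
    simp_rw [e]
    symm
    rw [Finset.sum_comm, hT, Finset.mul_sum]
    refine Finset.sum_congr rfl fun x _ => ?_
    rw [Finset.sum_comm, Finset.mul_sum]
    refine Finset.sum_congr rfl fun b _ => ?_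
    rw [Finset.sum_comm, Finset.mul_sum]
    refine Finset.sum_congr rfl fun c _ => ?_
    rw [Finset.sum_comm]
    simp_rw [← Finset.mul_sum, AddChar.sum_apply_eq_ite, sub_eq_zero]
    simp [hn]
    ring
  have hnorm : n * ‖T‖ ≤ ‖∑ x ∈ D, f x * γ₀ x‖ * A.card * (n * n) := by
    calc n * ‖T‖ = ‖(n : ℂ) * T‖ := by simp [abs_of_pos hn0]
      _ ≤ ∑ γ : AddChar G ℂ, ‖∑ x ∈ D, f x * γ₀ x‖ * A.card * ‖∑ c, g c * γ c‖ ^ 2 := by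
          rw [hfour]
          refine (norm_sum_le _ _).trans (Finset.sum_le_sum fun γ _ => ?_)
          rw [norm_mul, norm_mul, norm_pow, RCLike.norm_conj]
          have h1 := hγ₀ γ (Finset.mem_univ _)
          have h2 : ‖∑ b ∈ A, f b * γ b‖ ≤ A.card := by
            refine (norm_sum_le _ _).trans ?_
            simp [hf, AddChar.norm_apply]
          gcongr
      _ = _ := by
          rw [← Finset.mul_sum, parseval]
          simp [hg, hn]
  have hTT : T.re ≤ ‖T‖ := Complex.re_le_norm T
  have : ((1 - κ - 2 * ε) * D.card) * (A.card * (n * n))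
      ≤ ‖∑ x ∈ D, f x * γ₀ x‖ * (A.card * (n * n)) := by
    calc _ = n * ((1 - κ - 2 * ε) * D.card * (A.card * n)) := by ring
      _ ≤ n * ‖T‖ := by gcongr; linarith
      _ ≤ _ := hnorm.trans (by rw [mul_assoc])
  exact le_of_mul_le_mul_right this (by positivity)

lemma twelve (h : G → ℂ) :
    (Fintype.card G : ℂ) * ∑ q ∈ Gam12 G, (∏ i, h (q.1 i)) * (∏ i, conj (h (q.2 i)))
      = ((∑ γ : AddChar G ℂ, ‖∑ x, h x * γ x‖ ^ 12 : ℝ) : ℂ) := by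
  push_cast
  have e : ∀ γ : AddChar G ℂ, ((‖∑ x, h x * γ x‖ : ℂ)) ^ 12
      = ∑ q : (Fin 6 → G) × (Fin 6 → G), (∏ i, h (q.1 i)) * (∏ i, conj (h (q.2 i))) *
        γ (∑ i, q.1 i - ∑ i, q.2 i) := by
    intro γ
    have : ((‖∑ x, h x * γ x‖ : ℂ)) ^ 12 = (∑ x, h x * γ x) ^ 6 * (∑ x, conj (h x) * γ (-x)) ^ 6 := by
      have e1 : (∑ x, conj (h x) * γ (-x)) = conj (∑ x, h x * γ x) := by
        rw [map_sum]; exact Finset.sum_congr rfl fun x _ => by rw [map_mul, conj_char]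
      rw [e1, ← mul_pow, Complex.mul_conj', ← pow_mul]
    rw [this, Fintype.sum_pow, Fintype.sum_pow, Finset.sum_mul_sum, Fintype.sum_prod_type]
    refine Finset.sum_congr rfl fun x _ => Finset.sum_congr rfl fun y _ => ?_
    rw [Finset.prod_mul_distrib, Finset.prod_mul_distrib, sub_eq_add_neg, AddChar.map_add_eq_mul,
      ← Finset.sum_neg_distrib, addChar_sum, addChar_sum]
    ring
  simp_rw [e]
  rw [Finset.sum_comm, Gam12, Finset.sum_filter, Finset.mul_sum]
  refine Finset.sum_congr rfl fun q _ => ?_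
  rw [← Finset.mul_sum, AddChar.sum_apply_eq_ite]
  simp only [sub_eq_zero]
  split_ifs <;> ring

lemma card_Gam12 : ((Gam12 G).card : ℝ) = (Fintype.card G : ℝ) ^ 11 := by
  have h := twelve (G := G) (fun _ => 1)
  simp only [Finset.prod_const_one, map_one, mul_one, Finset.sum_const, nsmul_eq_mul, one_mul,
    AddChar.sum_eq_ite] at h
  have h1 : (∑ γ : AddChar G ℂ, ‖(if γ = 0 then (Fintype.card G : ℂ) else 0)‖ ^ 12 : ℝ)
      = (Fintype.card G : ℝ) ^ 12 := by
    rw [Finset.sum_eq_single 0]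
    · simp
    · intro b _ hb; simp [hb]
    · simp
  rw [h1] at h
  have h2 : (Fintype.card G : ℝ) * (Gam12 G).card = (Fintype.card G : ℝ) ^ 12 := by exact_mod_cast h
  have hn0 : (0 : ℝ) < Fintype.card G := by exact_mod_cast Fintype.card_pos
  refine mul_left_cancel₀ hn0.ne' (h2.trans (by ring))

/-- the tuples being counted -/
def goodTuple {H : Type} [AddCommGroup H] (U : Finset G) (φ : G → H)
    (q : (Fin 6 → G) × (Fin 6 → G)) : Prop :=
  (∀ i, q.1 i ∈ U) ∧ (∀ i, q.2 i ∈ U) ∧ (∑ i, φ (q.1 i)) = (∑ i, φ (q.2 i))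

/-- every unimodular Freiman character correlates with a character -/
def Corr (t : ℝ) (U : Finset G) : Prop :=
  ∀ f : G → ℂ, (∀ x, ‖f x‖ = 1) →
    (∀ a ∈ U, ∀ b ∈ U, ∀ c ∈ U, ∀ d ∈ U, a + b = c + d → f a * f b = f c * f d) →
    ∃ γ : AddChar G ℂ, t * U.card ≤ ‖∑ x ∈ U, f x * γ x‖

lemma count_finite {H : Type} [AddCommGroup H] [Finite H] {t : ℝ} (ht : 0 ≤ t) (U : Finset G)
    (hU : Corr t U) (φ : G → H) (hφ : FreimanHomOn U φ) :
    (t * U.card) ^ 12 ≤ Fintype.card G * ∑ q ∈ Gam12 G, (if goodTuple U φ q then (1 : ℝ) else 0) := by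
  have := Fintype.ofFinite H
  have hH0 : (0 : ℝ) < Fintype.card H := by exact_mod_cast Fintype.card_pos
  have h1 : ∀ χ : AddChar H ℂ, (t * U.card) ^ 12 ≤
      ∑ γ : AddChar G ℂ, ‖∑ x, ((ind U x : ℂ) * χ (φ x)) * γ x‖ ^ 12 := by
    intro χ
    obtain ⟨γ, hγ⟩ := hU (fun x => χ (φ x)) (fun x => AddChar.norm_apply _ _) (by
      intro a ha b hb c hc d hd habcd
      rw [← AddChar.map_add_eq_mul, ← AddChar.map_add_eq_mul, hφ a ha b hb c hc d hd habcd])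
    have e : ∑ x ∈ U, χ (φ x) * γ x = ∑ x, ((ind U x : ℂ) * χ (φ x)) * γ x := by
      rw [← sum_ite_mem_univ']
      refine Finset.sum_congr rfl fun x _ => ?_
      by_cases hx : x ∈ U <;> simp [ind, hx]
    rw [e] at hγ
    refine le_trans (by gcongr) (Finset.single_le_sum (f := fun γ : AddChar G ℂ =>
      ‖∑ x, ((ind U x : ℂ) * χ (φ x)) * γ x‖ ^ 12) (fun _ _ => by positivity) (Finset.mem_univ γ))
  have h2 : ((∑ χ : AddChar H ℂ, ∑ γ : AddChar G ℂ,
      ‖∑ x, ((ind U x : ℂ) * χ (φ x)) * γ x‖ ^ 12 : ℝ) : ℂ)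
      = ((Fintype.card H * (Fintype.card G * ∑ q ∈ Gam12 G,
          (if goodTuple U φ q then (1 : ℝ) else 0)) : ℝ) : ℂ) := by
    rw [Complex.ofReal_sum]
    simp_rw [← twelve]
    rw [← Finset.mul_sum, Finset.sum_comm]
    push_cast
    rw [mul_left_comm]
    congr 1
    rw [Finset.mul_sum]
    refine Finset.sum_congr rfl fun q _ => ?_
    have e : ∀ χ : AddChar H ℂ, (∏ i, ((ind U (q.1 i) : ℂ) * χ (φ (q.1 i)))) *
        (∏ i, conj ((ind U (q.2 i) : ℂ) * χ (φ (q.2 i))))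
        = ((∏ i, (ind U (q.1 i) : ℂ)) * ∏ i, (ind U (q.2 i) : ℂ)) *
          χ (∑ i, φ (q.1 i) - ∑ i, φ (q.2 i)) := by
      intro χ
      rw [sub_eq_add_neg, AddChar.map_add_eq_mul,
        ← Finset.sum_neg_distrib, addChar_sum, addChar_sum]
      simp only [map_mul, Complex.conj_ofReal, conj_char, Finset.prod_mul_distrib]
      ring
    simp_rw [e]
    rw [← Finset.mul_sum, AddChar.sum_apply_eq_ite]
    simp only [sub_eq_zero]
    by_cases ha : ∀ i, q.1 i ∈ U
    · by_cases hb : ∀ i, q.2 i ∈ U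
      · by_cases hc : (∑ i, φ (q.1 i)) = (∑ i, φ (q.2 i))
        · simp [goodTuple, ha, hb, hc, ind]
        · simp [goodTuple, ha, hb, hc, ind]
      · have : ∏ i, (ind U (q.2 i) : ℂ) = 0 := by
          push Not at hb
          obtain ⟨i, hi⟩ := hb
          exact Finset.prod_eq_zero (Finset.mem_univ i) (by simp [ind, hi])
        simp [goodTuple, hb, this]
    · have : ∏ i, (ind U (q.1 i) : ℂ) = 0 := by
        push Not at ha
        obtain ⟨i, hi⟩ := ha
        exact Finset.prod_eq_zero (Finset.mem_univ i) (by simp [ind, hi])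
      simp [goodTuple, ha, this]
  have h3 : (∑ χ : AddChar H ℂ, ∑ γ : AddChar G ℂ,
      ‖∑ x, ((ind U x : ℂ) * χ (φ x)) * γ x‖ ^ 12 : ℝ)
      = (Fintype.card H * (Fintype.card G * ∑ q ∈ Gam12 G,
          (if goodTuple U φ q then (1 : ℝ) else 0)) : ℝ) := by exact_mod_cast h2
  have h4 : (Fintype.card H : ℝ) * (t * U.card) ^ 12 ≤ ∑ χ : AddChar H ℂ, ∑ γ : AddChar G ℂ,
      ‖∑ x, ((ind U x : ℂ) * χ (φ x)) * γ x‖ ^ 12 := by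
    calc _ = ∑ χ : AddChar H ℂ, (t * U.card) ^ 12 := by
          simp only [Finset.sum_const, Finset.card_univ, AddChar.card_eq, nsmul_eq_mul]
      _ ≤ _ := Finset.sum_le_sum fun χ _ => h1 χ
  rw [h3] at h4
  exact le_of_mul_le_mul_left h4 hH0

lemma exists_finite_quot {H : Type} [AddCommGroup H] [AddGroup.FG H] (T : Finset H)
    (hT : ∀ h ∈ T, h ≠ 0) :
    ∃ (K : Type) (_ : AddCommGroup K) (_ : Finite K) (ψ : H →+ K), ∀ h ∈ T, ψ h ≠ 0 := by
  induction T using Finset.induction_on with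
  | empty => exact ⟨PUnit, inferInstance, inferInstance, 0, by simp⟩
  | insert a s ha ih =>
    obtain ⟨K, i1, i2, ψ, hψ⟩ := ih (fun h hh => hT h (Finset.mem_insert_of_mem hh))
    obtain ⟨c, hc⟩ := CharacterModule.exists_character_apply_ne_zero_of_ne_zero
      (hT a (Finset.mem_insert_self a s))
    let c' : H →+ AddCircle (1 : ℚ) := c
    have hfg : AddGroup.FG c'.range := inferInstance
    have hfin : Finite c'.range := by
      refine AddCommGroup.finite_of_fg_isAddTorsion _ ?_
      intro x
      obtain ⟨x, hx⟩ := x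
      obtain ⟨r, rfl⟩ := QuotientAddGroup.mk_surjective x
      rw [isOfFinAddOrder_iff_nsmul_eq_zero]
      refine ⟨r.den, r.den_pos, ?_⟩
      apply Subtype.ext
      have h2 : ((r.den • r : ℚ) : AddCircle (1 : ℚ)) = 0 := by
        rw [AddCircle.coe_eq_zero_iff]
        refine ⟨r.num, ?_⟩
        simp [Rat.den_mul_eq_num]
      exact h2
    refine ⟨K × c'.range, inferInstance, inferInstance, ψ.prod c'.rangeRestrict, ?_⟩
    intro h hh
    rcases Finset.mem_insert.mp hh with rfl | hh
    · intro h0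
      apply hc
      have := congrArg (fun z => (z.2 : AddCircle (1 : ℚ))) h0
      have h1 : c' h = 0 := by simpa using this
      exact h1
    · intro h0
      exact hψ h hh (congrArg Prod.fst h0)

lemma count_fg {H : Type} [AddCommGroup H] [AddGroup.FG H] {t : ℝ} (ht : 0 ≤ t) (U : Finset G)
    (hU : Corr t U) (φ : G → H) (hφ : FreimanHomOn U φ) :
    (t * U.card) ^ 12 ≤ Fintype.card G * ∑ q ∈ Gam12 G, (if goodTuple U φ q then (1 : ℝ) else 0) := by
  obtain ⟨K, i1, i2, ψ, hψ⟩ := exists_finite_quot (H := H)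
    (((Gam12 G).image fun q => ∑ i, φ (q.1 i) - ∑ i, φ (q.2 i)).filter (· ≠ 0)) (by
      intro h hh; exact (Finset.mem_filter.mp hh).2)
  have := count_finite ht U hU (fun x => ψ (φ x)) (by
    intro a ha b hb c hc d hd habcd
    rw [← map_add, ← map_add, hφ a ha b hb c hc d hd habcd])
  refine this.trans ?_
  gcongr with q hq
  by_cases hg : goodTuple U (fun x => ψ (φ x)) q
  · have : goodTuple U φ q := by
      refine ⟨hg.1, hg.2.1, ?_⟩
      by_contra hne
      have h1 := hg.2.2
      rw [← map_sum, ← map_sum, ← sub_eq_zero, ← map_sub] at h1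
      refine hψ _ ?_ h1
      rw [Finset.mem_filter, Finset.mem_image]
      exact ⟨⟨q, hq, rfl⟩, sub_ne_zero.mpr hne⟩
    simp [hg, this]
  · rw [if_neg hg]; split_ifs <;> norm_num

lemma final_bound {H : Type} [AddCommGroup H] [AddGroup.FG H] {t : ℝ} (ht : 0 ≤ t) (U : Finset G)
    (hU0 : 0 < U.card) (hU : Corr t U) (φ : G → H) (hφ : FreimanHomOn U φ) :
    t ^ 12 ≤ (∑ q ∈ Gam12 G,
                    (∏ i, charMeas U (q.1 i)) * (∏ i, charMeas U (q.2 i)) *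
                      (if (∀ i, q.1 i ∈ U) ∧ (∀ i, q.2 i ∈ U) ∧
                          (∑ i, φ (q.1 i)) = (∑ i, φ (q.2 i)) then 1 else 0)) /
                    ((Gam12 G).card : ℝ) := by
  have h := count_fg ht U hU φ hφ
  have hn0 : (0 : ℝ) < Fintype.card G := by exact_mod_cast Fintype.card_pos
  have hu0 : (0 : ℝ) < U.card := by exact_mod_cast hU0
  have e : ∀ q : (Fin 6 → G) × (Fin 6 → G), (∏ i, charMeas U (q.1 i)) * (∏ i, charMeas U (q.2 i)) *
      (if (∀ i, q.1 i ∈ U) ∧ (∀ i, q.2 i ∈ U) ∧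
      (∑ i, φ (q.1 i)) = (∑ i, φ (q.2 i)) then (1 : ℝ) else 0)
      = ((Fintype.card G : ℝ) / U.card) ^ 12 * (if goodTuple U φ q then (1 : ℝ) else 0) := by
    intro q
    by_cases hg : goodTuple U φ q
    · have hg' := hg
      unfold goodTuple at hg
      rw [if_pos hg, if_pos hg']
      simp [charMeas, hg.1, hg.2.1]
      ring
    · have hg' := hg
      unfold goodTuple at hg
      rw [if_neg hg, if_neg hg']; simp
  simp_rw [e]
  rw [← Finset.mul_sum, card_Gam12, le_div_iff₀ (by positivity)]
  generalize (∑ q ∈ Gam12 G, (if goodTuple U φ q then (1 : ℝ) else 0)) = N at *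
  rw [mul_pow] at h
  rw [div_pow, div_mul_eq_mul_div, le_div_iff₀ (by positivity)]
  nlinarith [mul_le_mul_of_nonneg_left h (pow_pos hn0 11).le]

end fourier

section det
variable {G : Type} [AddCommGroup G] [Fintype G]

open ComplexConjugate

/-- `t` represents `d` -/
def IsRep (A B C : Finset G) (d : G) (t : G × G × G) : Prop :=
  t.1 ∈ A ∧ t.2.1 ∈ B ∧ t.2.2 ∈ C ∧ d + t.2.2 = t.1 + t.2.1

/-- a chosen representation -/
def repT (A B C : Finset G) (d : G) : G × G × G :=
  if h : ∃ t, IsRep A B C d t then h.choose else (0, 0, 0)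

/-- representable elements -/
def RR (A B C : Finset G) : Finset G := Finset.univ.filter fun d => ∃ t, IsRep A B C d t

lemma repT_spec {A B C : Finset G} {d : G} (h : d ∈ RR A B C) : IsRep A B C d (repT A B C d) := by
  have h' : ∃ t, IsRep A B C d t := (Finset.mem_filter.mp h).2
  rw [repT, dif_pos h']
  exact h'.choose_spec

lemma mem_RR_of_rep {A B C : Finset G} {d : G} (h : d ∉ RR A B C) : rep A B C d = 0 := by
  unfold rep
  refine Finset.sum_eq_zero fun a _ => Finset.sum_eq_zero fun b _ => ?_
  by_contra hne
  apply h
  refine Finset.mem_filter.mpr ⟨Finset.mem_univ _, (a, b, a + b - d), ?_⟩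
  unfold ind at hne
  by_cases ha : a ∈ A <;> by_cases hb : b ∈ B <;> by_cases hc : a + b - d ∈ C <;>
    simp_all [IsRep]

/-- extension of `s` to representable elements -/
def gext (A B C : Finset G) (s : G → ℂ) (d : G) : ℂ :=
  s (repT A B C d).1 * s (repT A B C d).2.1 * conj (s (repT A B C d).2.2)

/-- inconsistency -/
def Inc (A B C : Finset G) (e1 : ℝ) (s : G → ℂ) (x b c : G) : Prop :=
  x ∈ RR A B C ∧ c ∈ RR A B C ∧ x + b - c ∈ RR A B C ∧
    10 * e1 < ‖gext A B C s x * s b - gext A B C s c * gext A B C s (x + b - c)‖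

/-- the family of roundings -/
def roundings (Z : Finset ℂ) (V : Finset G) : Finset (G → ℂ) :=
  Fintype.piFinset fun x => if x ∈ V then Z else {1}

/-- count of inconsistent triples -/
def incCount (A B C D : Finset G) (e1 : ℝ) (s : G → ℂ) : ℝ :=
  ∑ x ∈ D, ∑ b ∈ A, ∑ c, if Inc A B C e1 s x b c then (1 : ℝ) else 0

lemma norm_mul_sub_le {u v u' v' : ℂ} (hv : ‖v‖ = 1) (hu : ‖u'‖ = 1) :
    ‖u * v - u' * v'‖ ≤ ‖u - u'‖ + ‖v - v'‖ := by
  have : u * v - u' * v' = (u - u') * v + u' * (v - v') := by ring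
  rw [this]
  refine (norm_add_le _ _).trans ?_
  simp [hv, hu]

lemma det (A B C D E F : Finset G) (Z : Finset ℂ) {e1 ε τ : ℝ} (he1 : 0 < e1)
    (hZ1 : ∀ z ∈ Z, ‖z‖ = 1) (hZ : ∀ z : ℂ, ‖z‖ = 1 → ∃ w ∈ Z, ‖z - w‖ ≤ e1)
    (hA : 0 < A.card) (hR : ((RR A B C)ᶜ.card : ℝ) ≤ ε * Fintype.card G)
    (hDR : ((D \ RR A B C).card : ℝ) ≤ ε * D.card)
    (hno : ∀ s ∈ roundings Z (A ∪ B ∪ C),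
      (∀ x ∈ D, ∀ b ∈ A, ∀ c ∈ E, Inc A B C e1 s x b c → x + b - c ∉ F) →
      incCount A B C D e1 s ≤ ε * Fintype.card G * (D.card * A.card))
    (hU : (A.card + B.card + C.card + E.card + F.card : ℝ) ≤ ε * D.card)
    (hτ : 14 * e1 + 10 * ε ≤ τ) (hτ0 : 0 ≤ τ) :
    Corr (1 - τ) (A ∪ (B ∪ (C ∪ (D ∪ (E ∪ F))))) := by
  set U := A ∪ (B ∪ (C ∪ (D ∪ (E ∪ F)))) with hUdef
  intro f hf hfr
  choose! w hw using hZ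
  set s : G → ℂ := fun x => if x ∈ A ∪ B ∪ C then w (f x) else 1 with hs
  have hsmem : s ∈ roundings Z (A ∪ B ∪ C) := by
    rw [roundings, Fintype.mem_piFinset]
    intro x
    by_cases hx : x ∈ A ∪ B ∪ C
    · simp only [hs, if_pos hx]; exact (hw _ (hf x)).1
    · simp only [hs, if_neg hx]; simp
  have hs1 : ∀ x, ‖s x‖ = 1 := by
    intro x
    by_cases hx : x ∈ A ∪ B ∪ C
    · simp only [hs, if_pos hx]; exact hZ1 _ (hw _ (hf x)).1
    · simp only [hs, if_neg hx]; simp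
  have hsf : ∀ x ∈ A ∪ B ∪ C, ‖f x - s x‖ ≤ e1 := by
    intro x hx
    simp only [hs, if_pos hx]; exact (hw _ (hf x)).2
  set g := gext A B C s with hg
  have hg1 : ∀ x, ‖g x‖ = 1 := by intro x; simp [hg, gext, hs1]
  have hAU : ∀ x ∈ A, x ∈ U := fun x hx => by simp [hUdef, hx]
  have hBU : ∀ x ∈ B, x ∈ U := fun x hx => by simp [hUdef, hx]
  have hCU : ∀ x ∈ C, x ∈ U := fun x hx => by simp [hUdef, hx]
  have hDU : ∀ x ∈ D, x ∈ U := fun x hx => by simp [hUdef, hx]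
  have hEU : ∀ x ∈ E, x ∈ U := fun x hx => by simp [hUdef, hx]
  have hFU : ∀ x ∈ F, x ∈ U := fun x hx => by simp [hUdef, hx]
  have hfg : ∀ x ∈ U, x ∈ RR A B C → ‖f x - g x‖ ≤ 3 * e1 := by
    intro x hxU hxR
    obtain ⟨ha, hb, hc, he⟩ := repT_spec hxR
    set t := repT A B C x with ht
    have h1 := hfr x hxU t.2.2 (hCU _ hc) t.1 (hAU _ ha) t.2.1 (hBU _ hb) he
    have h2 : f t.2.2 * conj (f t.2.2) = 1 := by rw [Complex.mul_conj']; simp [hf]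
    have h3 : f x = f t.1 * f t.2.1 * conj (f t.2.2) := by
      rw [← h1, mul_assoc, h2, mul_one]
    have h4 : g x = s t.1 * s t.2.1 * conj (s t.2.2) := rfl
    rw [h3, h4]
    refine (norm_mul_sub_le (by simp [hf]) (by simp [hs1])).trans ?_
    have h5 := norm_mul_sub_le (u := f t.1) (v := f t.2.1) (u' := s t.1) (v' := s t.2.1)
      (hf _) (hs1 _)
    have h6 : ‖conj (f t.2.2) - conj (s t.2.2)‖ ≤ e1 := by
      rw [← map_sub, RCLike.norm_conj]; exact hsf _ (by simp [hc])
    have h7 := hsf t.1 (by simp [ha])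
    have h8 := hsf t.2.1 (by simp [hb])
    linarith
  have hcount := hno s hsmem (by
    rintro x hx b hb c hc ⟨h1, h2, h3, h4⟩ hF
    have e1' := hfg x (hDU _ hx) h1
    have e2 := hsf b (by simp [hb])
    have e3 := hfg c (hEU _ hc) h2
    have e4 := hfg _ (hFU _ hF) h3
    have e5 := hfr x (hDU _ hx) b (hAU _ hb) c (hEU _ hc) _ (hFU _ hF) (by abel)
    have e6 := norm_mul_sub_le (u := f x) (v := f b) (u' := g x) (v' := s b) (hf _) (hg1 _)
    have e7 := norm_mul_sub_le (u := f c) (v := f (x + b - c)) (u' := g c) (v' := g (x + b - c))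
      (hf _) (hg1 _)
    rw [e5] at e6
    have e8 : ‖g x * s b - g c * g (x + b - c)‖ ≤
        ‖f c * f (x + b - c) - g x * s b‖ + ‖f c * f (x + b - c) - g c * g (x + b - c)‖ := by
      have : g x * s b - g c * g (x + b - c) =
        (f c * f (x + b - c) - g c * g (x + b - c)) - (f c * f (x + b - c) - g x * s b) := by ring
      rw [this]
      refine (norm_sub_le _ _).trans (by rw [add_comm])
    linarith)
  have hn0 : (0 : ℝ) < Fintype.card G := by exact_mod_cast Fintype.card_pos
  have hpt : ∀ x ∈ D, ∀ b ∈ A, ∀ c,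
      (if 14 * e1 < ‖f x * f b - g c * g (x + b - c)‖ then (1 : ℝ) else 0) ≤
      (if x ∉ RR A B C then (1 : ℝ) else 0) + (if c ∉ RR A B C then (1 : ℝ) else 0) +
      (if x + b - c ∉ RR A B C then (1 : ℝ) else 0) + (if Inc A B C e1 s x b c then (1 : ℝ) else 0) := by
    intro x hx b hb c
    have hnn : ∀ (P : Prop) [Decidable P], (0 : ℝ) ≤ if P then (1 : ℝ) else 0 := fun P _ => by split_ifs <;> norm_num
    have n1 := hnn (x ∉ RR A B C)
    have n2 := hnn (c ∉ RR A B C)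
    have n3 := hnn (x + b - c ∉ RR A B C)
    have n4 := hnn (Inc A B C e1 s x b c)
    by_cases h0 : 14 * e1 < ‖f x * f b - g c * g (x + b - c)‖
    swap
    · rw [if_neg h0]; linarith
    rw [if_pos h0]
    by_cases h1 : x ∈ RR A B C
    swap
    · rw [if_pos h1] at n1 ⊢; linarith
    by_cases h2 : c ∈ RR A B C
    swap
    · rw [if_pos h2] at n2 ⊢; linarith
    by_cases h3 : x + b - c ∈ RR A B C
    swap
    · rw [if_pos h3] at n3 ⊢; linarith
    have h4 : Inc A B C e1 s x b c := by
      refine ⟨h1, h2, h3, ?_⟩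
      have e1' := hfg x (hDU _ hx) h1
      have e2 := hsf b (by simp [hb])
      have e6 := norm_mul_sub_le (u := f x) (v := f b) (u' := g x) (v' := s b) (hf _) (hg1 _)
      have e8 : ‖f x * f b - g c * g (x + b - c)‖ ≤
        ‖f x * f b - g x * s b‖ + ‖g x * s b - g c * g (x + b - c)‖ := by
        have : f x * f b - g c * g (x + b - c) =
          (f x * f b - g x * s b) + (g x * s b - g c * g (x + b - c)) := by ring
        rw [this]
        exact norm_add_le _ _
      linarith
    rw [if_pos h4] at n4 ⊢; linarith
  have hcardR : ∑ c, (if c ∉ RR A B C then (1 : ℝ) else 0) = ((RR A B C)ᶜ.card : ℝ) := by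
    rw [Finset.sum_boole]; congr 2; ext; simp
  have hsum : ∑ x ∈ D, ∑ b ∈ A, ∑ c,
      (if 14 * e1 < ‖f x * f b - g c * g (x + b - c)‖ then (1 : ℝ) else 0)
      ≤ (4 * ε) * Fintype.card G * (D.card * A.card) := by
    calc _ ≤ ∑ x ∈ D, ∑ b ∈ A, ∑ c, ((if x ∉ RR A B C then (1 : ℝ) else 0) +
            (if c ∉ RR A B C then (1 : ℝ) else 0) +
            (if x + b - c ∉ RR A B C then (1 : ℝ) else 0) +
            (if Inc A B C e1 s x b c then (1 : ℝ) else 0)) :=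
          Finset.sum_le_sum fun x hx => Finset.sum_le_sum fun b hb =>
            Finset.sum_le_sum fun c _ => hpt x hx b hb c
      _ = ((D \ RR A B C).card : ℝ) * (A.card * Fintype.card G) +
          (D.card * A.card) * ((RR A B C)ᶜ.card : ℝ) + (D.card * A.card) * ((RR A B C)ᶜ.card : ℝ) +
          incCount A B C D e1 s := by
          simp only [Finset.sum_add_distrib]
          have q1 : ∑ x ∈ D, ∑ b ∈ A, ∑ c : G, (if x ∉ RR A B C then (1 : ℝ) else 0)
              = ((D \ RR A B C).card : ℝ) * (A.card * Fintype.card G) := by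
            have : ((D \ RR A B C).card : ℝ) = ∑ x ∈ D, (if x ∉ RR A B C then (1 : ℝ) else 0) := by
              rw [Finset.sum_boole, Finset.sdiff_eq_filter]
            rw [this, Finset.sum_mul]
            refine Finset.sum_congr rfl fun x _ => ?_
            simp only [Finset.sum_const, nsmul_eq_mul, Finset.card_univ]
            ring
          have q2 : ∑ x ∈ D, ∑ b ∈ A, ∑ c : G, (if c ∉ RR A B C then (1 : ℝ) else 0)
              = (D.card * A.card) * ((RR A B C)ᶜ.card : ℝ) := by
            rw [hcardR]
            simp only [Finset.sum_const, nsmul_eq_mul]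
            ring
          have q3 : ∑ x ∈ D, ∑ b ∈ A, ∑ c : G, (if x + b - c ∉ RR A B C then (1 : ℝ) else 0)
              = (D.card * A.card) * ((RR A B C)ᶜ.card : ℝ) := by
            rw [← q2]
            refine Finset.sum_congr rfl fun x _ => Finset.sum_congr rfl fun b _ => ?_
            exact Equiv.sum_comp (Equiv.subLeft (x + b))
              (fun c => if c ∉ RR A B C then (1 : ℝ) else 0)
          rw [q1, q2, q3]
          rfl
      _ ≤ (ε * D.card) * (A.card * Fintype.card G) +
          (D.card * A.card) * (ε * Fintype.card G) + (D.card * A.card) * (ε * Fintype.card G) +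
          ε * Fintype.card G * (D.card * A.card) := by gcongr
      _ = _ := by ring
  obtain ⟨γ, hγ⟩ := fourier_dense D A f g hf hg1 (by positivity) hA hsum
  refine ⟨γ, ?_⟩
  have hDsub : D ⊆ U := hDU
  have hsplit : ∑ x ∈ U, f x * γ x = ∑ x ∈ D, f x * γ x + ∑ x ∈ U \ D, f x * γ x := by
    rw [add_comm, Finset.sum_sdiff hDsub]
  have hrest : ‖∑ x ∈ U \ D, f x * γ x‖ ≤ ((U \ D).card : ℝ) := by
    refine (norm_sum_le _ _).trans ?_
    simp [hf, AddChar.norm_apply]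
  have hUD : ((U \ D).card : ℝ) ≤ ε * D.card := by
    refine le_trans ?_ hU
    have h1 : U \ D ⊆ A ∪ (B ∪ (C ∪ (E ∪ F))) := by
      intro x hx
      simp only [hUdef, Finset.mem_sdiff, Finset.mem_union] at hx ⊢
      tauto
    have h2 : (U \ D).card ≤ A.card + (B.card + (C.card + (E.card + F.card))) := by
      refine (Finset.card_le_card h1).trans ((Finset.card_union_le _ _).trans ?_)
      gcongr
      refine ((Finset.card_union_le _ _).trans ?_)
      gcongr
      refine ((Finset.card_union_le _ _).trans ?_)
      gcongr
      exact (Finset.card_union_le _ _)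
    have h3 : ((U \ D).card : ℝ) ≤ A.card + (B.card + (C.card + (E.card + F.card))) := by
      exact_mod_cast h2
    linarith
  have hUc : (U.card : ℝ) = D.card + (U \ D).card := by
    have := Finset.card_sdiff_add_card_eq_card hDsub
    rw [← this]; push_cast; ring
  have htri : ‖∑ x ∈ D, f x * γ x‖ ≤ ‖∑ x ∈ U, f x * γ x‖ + ‖∑ x ∈ U \ D, f x * γ x‖ := by
    have : ∑ x ∈ D, f x * γ x = ∑ x ∈ U, f x * γ x - ∑ x ∈ U \ D, f x * γ x := by
      rw [hsplit]; ring
    rw [this]; exact norm_sub_le _ _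
  rw [hUc]
  have hd0 : (0 : ℝ) ≤ D.card := by positivity
  have hud0 : (0 : ℝ) ≤ (U \ D).card := by positivity
  nlinarith [mul_nonneg hτ0 hud0, mul_le_mul_of_nonneg_right hτ hd0]

end det

set_option linter.unusedSectionVars false

section core
variable {G : Type} [AddCommGroup G] [Fintype G]

/-- indicator of a proposition -/
def b01 (P : Prop) : ℝ := if P then 1 else 0

lemma b01_nonneg (P : Prop) : 0 ≤ b01 P := by unfold b01; split_ifs <;> norm_num

lemma b01_pos {P : Prop} (h : P) : b01 P = 1 := if_pos h

lemma b01_neg {P : Prop} (h : ¬ P) : b01 P = 0 := if_neg h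

lemma b01_mono {P Q : Prop} (h : P → Q) : b01 P ≤ b01 Q := by
  by_cases hP : P
  · rw [b01_pos hP, b01_pos (h hP)]
  · rw [b01_neg hP]; exact b01_nonneg Q

lemma b01_markov {a y : ℝ} (ha : 0 < a) (hy : 0 ≤ y) : b01 (a < y) ≤ y * a⁻¹ := by
  by_cases h : a < y
  · rw [b01_pos h, ← div_eq_mul_inv, le_div_iff₀ ha]; linarith
  · rw [b01_neg h]; positivity

/-- the six-fold expectation -/
def EX (p0 p1 p2 : ℝ)
    (f : Finset G → Finset G → Finset G → Finset G → Finset G → Finset G → ℝ) : ℝ :=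
  Ex p0 fun A => Ex p0 fun B => Ex p0 fun C => Ex p1 fun D => Ex p2 fun E => Ex p2 fun F =>
    f A B C D E F

lemma EX_mono {p0 p1 p2 : ℝ} (h0 : 0 ≤ p0) (h0' : p0 ≤ 1) (h1 : 0 ≤ p1) (h1' : p1 ≤ 1)
    (h2 : 0 ≤ p2) (h2' : p2 ≤ 1)
    {f g : Finset G → Finset G → Finset G → Finset G → Finset G → Finset G → ℝ}
    (h : ∀ A B C D E F, f A B C D E F ≤ g A B C D E F) :
    EX p0 p1 p2 f ≤ EX p0 p1 p2 g :=
  Ex_mono h0 h0' fun A => Ex_mono h0 h0' fun B => Ex_mono h0 h0' fun C => Ex_mono h1 h1' fun D =>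
    Ex_mono h2 h2' fun E => Ex_mono h2 h2' fun F => h A B C D E F

lemma EX_add (p0 p1 p2 : ℝ)
    (f g : Finset G → Finset G → Finset G → Finset G → Finset G → Finset G → ℝ) :
    EX p0 p1 p2 (fun A B C D E F => f A B C D E F + g A B C D E F)
      = EX p0 p1 p2 f + EX p0 p1 p2 g := by
  simp only [EX, Ex_add]

lemma EX_const (p0 p1 p2 c : ℝ) : EX (G := G) p0 p1 p2 (fun _ _ _ _ _ _ => c) = c := by
  simp only [EX, Ex_const]

lemma EX_union (p0 p1 p2 p : ℝ)
    (hp : 1 - p = (1 - p0) ^ 3 * (1 - p1) * (1 - p2) ^ 2) (f : Finset G → ℝ) :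
    EX p0 p1 p2 (fun A B C D E F => f (A ∪ (B ∪ (C ∪ (D ∪ (E ∪ F)))))) = Ex p f := by
  unfold EX
  have e1 : ∀ A B C D : Finset G,
      Ex p2 (fun E => Ex p2 (fun F => f (A ∪ (B ∪ (C ∪ (D ∪ (E ∪ F)))))))
      = Ex (p2 + p2 - p2 * p2) (fun V => f (A ∪ (B ∪ (C ∪ (D ∪ V))))) := fun A B C D =>
    Ex_union p2 p2 (fun V => f (A ∪ (B ∪ (C ∪ (D ∪ V)))))
  simp only [e1]
  have e2 := fun A B C : Finset G =>
    Ex_union p1 (p2 + p2 - p2 * p2) (fun V => f (A ∪ (B ∪ (C ∪ V))))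
  simp only [e2]
  generalize h3 : p1 + (p2 + p2 - p2 * p2) - p1 * (p2 + p2 - p2 * p2) = r3
  have e3 := fun A B : Finset G => Ex_union p0 r3 (fun V => f (A ∪ (B ∪ V)))
  simp only [e3]
  generalize h4 : p0 + r3 - p0 * r3 = r4
  have e4 := fun A : Finset G => Ex_union p0 r4 (fun V => f (A ∪ V))
  simp only [e4]
  rw [Ex_union]
  congr 1
  rw [← h4, ← h3]
  linear_combination hp

lemma chernoff_card {p : ℝ} (h0 : 0 ≤ p) (h1 : p ≤ 1) :
    Ex p (fun A : Finset G => b01 ((A.card : ℝ) ≤ p * Fintype.card G / 4))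
      ≤ Real.exp (-(p * Fintype.card G / 4)) := by
  have := chernoff (G := G) h0 h1 (fun _ => 1) (fun _ => by norm_num) (fun _ => le_rfl)
    (Fintype.card G : ℝ) (by simp)
  simpa [b01] using this

/-- size conditions -/
def SizeOK (p0 p1 δ : ℝ) (A B C D : Finset G) : Prop :=
  (A.card : ℝ) ≤ p0 * Fintype.card G / δ ∧ (B.card : ℝ) ≤ p0 * Fintype.card G / δ ∧
  (C.card : ℝ) ≤ p0 * Fintype.card G / δ ∧ p0 * Fintype.card G / 4 < (A.card : ℝ) ∧
  p1 * Fintype.card G / 4 < (D.card : ℝ)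

/-- the last bad event -/
def BadS (X ε e1 : ℝ) (Z : Finset ℂ) (A B C D E F : Finset G) : Prop :=
  ∃ s ∈ roundings Z (A ∪ B ∪ C), ε * Fintype.card G * (D.card * A.card) ≤ incCount A B C D e1 s ∧
    (∑ d, rep D A E d ^ 2 ≤ X ∧
      ∀ x ∈ D, ∀ b ∈ A, ∀ c ∈ E, Inc A B C e1 s x b c → x + b - c ∉ F)

lemma card_roundings (Z : Finset ℂ) (V : Finset G) : (roundings Z V).card = Z.card ^ V.card := by
  rw [roundings, Fintype.card_piFinset]
  have : ∀ x, (if x ∈ V then Z else {1} : Finset ℂ).card = if x ∈ V then Z.card else 1 := by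
    intro x; split_ifs <;> simp
  simp_rw [this, Finset.prod_ite_mem]
  simp

lemma badS_bound {p0 p1 p2 δ ε e1 : ℝ} (Z : Finset ℂ) (hZ : 0 < Z.card) (h0 : 0 < p0)
    (h1 : 0 < p1) (h2 : 0 < p2) (h2' : p2 ≤ 1) (hδ : 0 < δ) (hε : 0 < ε)
    (hbig : Real.exp (3 * (p0 * Fintype.card G / δ) * Real.log Z.card) *
      (Real.exp (-(p2 * (ε * Fintype.card G) / 4)) +
        Real.exp (-(p2 * (ε ^ 2 * δ * Fintype.card G / 8192) / 4))) ≤ δ)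
    (A B C D : Finset G) :
    Ex p2 (fun E => Ex p2 (fun F => b01 (SizeOK p0 p1 δ A B C D ∧
      BadS (2 * (Fintype.card G : ℝ) ^ 5 * (p1 * p0 * p2) ^ 2 / δ) ε e1 Z A B C D E F))) ≤ δ := by
  set n : ℝ := (Fintype.card G : ℝ) with hn
  have hn0 : 0 < n := by rw [hn]; exact_mod_cast Fintype.card_pos
  by_cases hS : SizeOK p0 p1 δ A B C D
  swap
  · simp only [hS, false_and]
    rw [b01_neg (by simp), Ex_const, Ex_const]; exact hδ.le
  simp only [hS, true_and]
  obtain ⟨s1, s2, s3, s4, s5⟩ := hS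
  have hAc : (0 : ℝ) < A.card := lt_trans (by positivity) s4
  have hDc : (0 : ℝ) < D.card := lt_trans (by positivity) s5
  set X := 2 * n ^ 5 * (p1 * p0 * p2) ^ 2 / δ with hX
  set S := (roundings Z (A ∪ B ∪ C)).filter
    (fun s => ε * n * (D.card * A.card) ≤ incCount A B C D e1 s) with hSdef
  have hpt : ∀ E F : Finset G, b01 (BadS X ε e1 Z A B C D E F) ≤ ∑ s ∈ S,
      (if (∑ d, rep D A E d ^ 2 ≤ X ∧
      ∀ x ∈ D, ∀ b ∈ A, ∀ c ∈ E, Inc A B C e1 s x b c → x + b - c ∉ F) then (1 : ℝ) else 0) := by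
    intro E F
    by_cases hB : BadS X ε e1 Z A B C D E F
    · rw [b01_pos hB]
      obtain ⟨s, hs, hs1, hs2⟩ := hB
      have hsS : s ∈ S := Finset.mem_filter.mpr ⟨hs, hs1⟩
      refine le_trans ?_ (Finset.single_le_sum (fun i _ => by split_ifs <;> norm_num) hsS)
      rw [if_pos hs2]
    · rw [b01_neg hB]
      exact Finset.sum_nonneg fun i _ => by split_ifs <;> norm_num
  set bd := Real.exp (-(p2 * (ε * n) / 4)) + Real.exp (-(p2 * (ε ^ 2 * δ * n / 8192) / 4)) with hbd
  have hbd0 : 0 ≤ bd := by positivity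
  calc _ ≤ Ex p2 (fun E => Ex p2 (fun F => ∑ s ∈ S,
      (if (∑ d, rep D A E d ^ 2 ≤ X ∧
      ∀ x ∈ D, ∀ b ∈ A, ∀ c ∈ E, Inc A B C e1 s x b c → x + b - c ∉ F) then (1 : ℝ) else 0))) :=
        Ex_mono h2.le h2' fun E => Ex_mono h2.le h2' fun F => hpt E F
    _ = ∑ s ∈ S, Ex p2 (fun E => Ex p2 (fun F =>
      (if (∑ d, rep D A E d ^ 2 ≤ X ∧
      ∀ x ∈ D, ∀ b ∈ A, ∀ c ∈ E, Inc A B C e1 s x b c → x + b - c ∉ F) then (1 : ℝ) else 0))) := by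
        simp only [Ex_sum]
    _ ≤ ∑ s ∈ S, bd := by
        refine Finset.sum_le_sum fun s hs => ?_
        refine two_round h2 h2' D A (Inc A B C e1 s) (by positivity) (by positivity) hε
          (by exact_mod_cast hDc) (by exact_mod_cast hAc) ?_ (Finset.mem_filter.mp hs).2
        have hlow : p2 * (ε * n) / 4 * ((p1 * n / 4) * (p0 * n / 4))
            ≤ p2 * (ε * n) / 4 * (D.card * A.card) := by gcongr
        calc (ε ^ 2 * δ * n / 8192) * X
            = (p2 * (ε * n) / 4 * ((p1 * n / 4) * (p0 * n / 4))) ^ 2 := by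
              rw [hX]; field_simp; ring
          _ ≤ _ := by gcongr
    _ = S.card * bd := by rw [Finset.sum_const, nsmul_eq_mul]
    _ ≤ Real.exp (3 * (p0 * n / δ) * Real.log Z.card) * bd := by
        gcongr
        have hM : (0 : ℝ) < Z.card := by exact_mod_cast hZ
        have c1 : (S.card : ℝ) ≤ (Z.card : ℝ) ^ (A ∪ B ∪ C).card := by
          have c0 : S.card ≤ Z.card ^ (A ∪ B ∪ C).card := by
            rw [← card_roundings]; exact Finset.card_filter_le _ _
          exact_mod_cast c0
        refine c1.trans ?_
        rw [← Real.rpow_natCast, Real.rpow_def_of_pos hM, mul_comm]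
        have hl : 0 ≤ Real.log Z.card := Real.log_natCast_nonneg _
        have c2 : ((A ∪ B ∪ C).card : ℝ) ≤ A.card + B.card + C.card := by
          have := (Finset.card_union_le (A ∪ B) C).trans
            (Nat.add_le_add_right (Finset.card_union_le A B) _)
          exact_mod_cast this
        gcongr
        linarith
    _ ≤ δ := hbig



lemma core {p p0 p1 p2 δ ε e1 τ : ℝ} (Z : Finset ℂ) (hZ0 : 0 < Z.card) (h0 : 0 < p0)
    (h02 : p0 ≤ p2) (h21 : p2 ≤ p1) (h1' : p1 ≤ 1) (hδ : 0 < δ) (hε : 0 < ε) (he1 : 0 < e1)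
    (hp : 1 - p = (1 - p0) ^ 3 * (1 - p1) * (1 - p2) ^ 2)
    (hZ1 : ∀ z ∈ Z, ‖z‖ = 1) (hZ : ∀ z : ℂ, ‖z‖ = 1 → ∃ w ∈ Z, ‖z - w‖ ≤ e1)
    (hτ : 14 * e1 + 10 * ε ≤ τ)
    (hw1 : 3 / (p0 * Fintype.card G) + 4 / (p0 ^ 3 * (Fintype.card G : ℝ) ^ 2) ≤ 1)
    (hw2 : 3 / (p0 * Fintype.card G) + 4 / (p0 ^ 3 * (Fintype.card G : ℝ) ^ 2) ≤ ε * δ / 4)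
    (hch : Real.exp (-(p0 * Fintype.card G / 4)) ≤ δ)
    (hsz : 3 * (p0 / δ) + 2 * (p2 / δ) ≤ ε * (p1 / 4))
    (hbig : Real.exp (3 * (p0 * Fintype.card G / δ) * Real.log Z.card) *
      (Real.exp (-(p2 * (ε * Fintype.card G) / 4)) +
        Real.exp (-(p2 * (ε ^ 2 * δ * Fintype.card G / 8192) / 4))) ≤ δ) :
    1 - 11 * δ ≤ Ex p (fun U : Finset G => b01 (0 < U.card ∧ Corr (1 - τ) U)) := by
  set n : ℝ := (Fintype.card G : ℝ) with hn
  have hn0 : 0 < n := by rw [hn]; exact_mod_cast Fintype.card_pos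
  have h2 : 0 < p2 := h0.trans_le h02
  have h1 : 0 < p1 := h2.trans_le h21
  have h2' : p2 ≤ 1 := h21.trans h1'
  have h0' : p0 ≤ 1 := h02.trans h2'
  set X := 2 * n ^ 5 * (p1 * p0 * p2) ^ 2 / δ with hX
  have hX0 : 0 < X := by positivity
  set w := 3 / (p0 * n) + 4 / (p0 ^ 3 * n ^ 2) with hw
  have hτ0 : 0 ≤ τ := by linarith
  -- pointwise bound
  have hpt : ∀ A B C D E F : Finset G, (1 : ℝ) ≤
      b01 (0 < (A ∪ (B ∪ (C ∪ (D ∪ (E ∪ F))))).card ∧ Corr (1 - τ) (A ∪ (B ∪ (C ∪ (D ∪ (E ∪ F)))))) +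
      (b01 (p0 * n / δ < A.card) + (b01 (p0 * n / δ < B.card) + (b01 (p0 * n / δ < C.card) +
      (b01 (p2 * n / δ < E.card) + (b01 (p2 * n / δ < F.card) +
      (b01 ((A.card : ℝ) ≤ p0 * n / 4) + (b01 ((D.card : ℝ) ≤ p1 * n / 4) +
      (b01 (ε * n < ((RR A B C)ᶜ.card : ℝ)) + (b01 (ε * p1 * n / 4 < ((D \ RR A B C).card : ℝ)) +
      (b01 (X < ∑ d, rep D A E d ^ 2) +
      b01 (SizeOK p0 p1 δ A B C D ∧ BadS X ε e1 Z A B C D E F))))))))))) := by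
    intro A B C D E F
    by_contra hcon
    push Not at hcon
    have key : ∀ {P : Prop}, b01 P < 1 → ¬ P := fun h hP => by rw [b01_pos hP] at h; exact h.false
    have n0 := b01_nonneg (0 < (A ∪ (B ∪ (C ∪ (D ∪ (E ∪ F))))).card ∧
      Corr (1 - τ) (A ∪ (B ∪ (C ∪ (D ∪ (E ∪ F))))))
    have n1 := b01_nonneg (p0 * n / δ < A.card)
    have n2 := b01_nonneg (p0 * n / δ < B.card)
    have n3 := b01_nonneg (p0 * n / δ < C.card)
    have n4 := b01_nonneg (p2 * n / δ < E.card)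
    have n5 := b01_nonneg (p2 * n / δ < F.card)
    have n6 := b01_nonneg ((A.card : ℝ) ≤ p0 * n / 4)
    have n7 := b01_nonneg ((D.card : ℝ) ≤ p1 * n / 4)
    have n8 := b01_nonneg (ε * n < ((RR A B C)ᶜ.card : ℝ))
    have n9 := b01_nonneg (ε * p1 * n / 4 < ((D \ RR A B C).card : ℝ))
    have n10 := b01_nonneg (X < ∑ d, rep D A E d ^ 2)
    have n11 := b01_nonneg (SizeOK p0 p1 δ A B C D ∧ BadS X ε e1 Z A B C D E F)
    have m0 := key (P := 0 < (A ∪ (B ∪ (C ∪ (D ∪ (E ∪ F))))).card ∧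
      Corr (1 - τ) (A ∪ (B ∪ (C ∪ (D ∪ (E ∪ F)))))) (by linarith)
    have m1 := key (P := p0 * n / δ < A.card) (by linarith)
    have m2 := key (P := p0 * n / δ < B.card) (by linarith)
    have m3 := key (P := p0 * n / δ < C.card) (by linarith)
    have m4 := key (P := p2 * n / δ < E.card) (by linarith)
    have m5 := key (P := p2 * n / δ < F.card) (by linarith)
    have m6 := key (P := (A.card : ℝ) ≤ p0 * n / 4) (by linarith)
    have m7 := key (P := (D.card : ℝ) ≤ p1 * n / 4) (by linarith)
    have m8 := key (P := ε * n < ((RR A B C)ᶜ.card : ℝ)) (by linarith)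
    have m9 := key (P := ε * p1 * n / 4 < ((D \ RR A B C).card : ℝ)) (by linarith)
    have m10 := key (P := X < ∑ d, rep D A E d ^ 2) (by linarith)
    have m11 := key (P := SizeOK p0 p1 δ A B C D ∧ BadS X ε e1 Z A B C D E F) (by linarith)
    clear hcon n0 n1 n2 n3 n4 n5 n6 n7 n8 n9 n10 n11
    push Not at m1 m2 m3 m4 m5 m6 m7 m8 m9 m10
    have hA0 : (0 : ℝ) < A.card := lt_trans (by positivity) m6
    have hA0' : 0 < A.card := by exact_mod_cast hA0
    apply m0
    refine ⟨lt_of_lt_of_le hA0' (Finset.card_le_card Finset.subset_union_left), ?_⟩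
    have hD1 : ε * (p1 * n / 4) ≤ ε * D.card := by gcongr
    refine det A B C D E F Z he1 hZ1 hZ hA0' m8 ?_ ?_ ?_ hτ hτ0
    · linarith
    · intro s hs hav
      by_contra hlt
      push Not at hlt
      exact m11 ⟨⟨m1, m2, m3, m6, m7⟩, s, hs, hlt.le, m10, hav⟩
    · have := mul_le_mul_of_nonneg_right hsz hn0.le
      have e : (3 * (p0 / δ) + 2 * (p2 / δ)) * n = 3 * (p0 * n / δ) + 2 * (p2 * n / δ) := by ring
      have e' : ε * (p1 / 4) * n = ε * (p1 * n / 4) := by ring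
      linarith
  have hE := EX_mono h0.le h0' h1.le h1' h2.le h2' hpt
  rw [EX_const] at hE
  simp only [EX_add] at hE
  rw [EX_union p0 p1 p2 p hp (fun U => b01 (0 < U.card ∧ Corr (1 - τ) U))] at hE
  have hcard0 : ∀ A : Finset G, (0 : ℝ) ≤ A.card := fun A => Nat.cast_nonneg _
  have mk : ∀ q : ℝ, 0 < q → q ≤ 1 →
      Ex q (fun A : Finset G => b01 (q * n / δ < A.card)) ≤ δ := by
    intro q hq hq'
    have ha : 0 < q * n / δ := by positivity
    refine (Ex_mono hq.le hq' fun A => b01_markov ha (hcard0 A)).trans ?_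
    rw [Ex_mul_right, Ex_card]
    apply le_of_eq
    rw [← hn]; field_simp
  have b1 : EX p0 p1 p2 (fun A B C D E F : Finset G => b01 (p0 * n / δ < A.card)) ≤ δ := by
    simp only [EX, Ex_const]; exact mk p0 h0 h0'
  have b2 : EX p0 p1 p2 (fun A B C D E F : Finset G => b01 (p0 * n / δ < B.card)) ≤ δ := by
    simp only [EX, Ex_const]; exact mk p0 h0 h0'
  have b3 : EX p0 p1 p2 (fun A B C D E F : Finset G => b01 (p0 * n / δ < C.card)) ≤ δ := by
    simp only [EX, Ex_const]; exact mk p0 h0 h0'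
  have b4 : EX p0 p1 p2 (fun A B C D E F : Finset G => b01 (p2 * n / δ < E.card)) ≤ δ := by
    simp only [EX, Ex_const]; exact mk p2 h2 h2'
  have b5 : EX p0 p1 p2 (fun A B C D E F : Finset G => b01 (p2 * n / δ < F.card)) ≤ δ := by
    simp only [EX, Ex_const]; exact mk p2 h2 h2'
  have b6 : EX p0 p1 p2 (fun A B C D E F : Finset G => b01 ((A.card : ℝ) ≤ p0 * n / 4)) ≤ δ := by
    simp only [EX, Ex_const]; exact (chernoff_card h0.le h0').trans hch
  have b7 : EX p0 p1 p2 (fun A B C D E F : Finset G => b01 ((D.card : ℝ) ≤ p1 * n / 4)) ≤ δ := by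
    simp only [EX, Ex_const]
    refine (chernoff_card h1.le h1').trans (le_trans ?_ hch)
    have : p0 ≤ p1 := h02.trans h21
    rw [← hn]
    gcongr
  have hRw : Ex p0 (fun A : Finset G => Ex p0 (fun B => Ex p0 (fun C => ((RR A B C)ᶜ.card : ℝ))))
      ≤ n * w := by
    refine le_trans ?_ (Ex_unrep h0 h0')
    refine Ex_mono h0.le h0' fun A => Ex_mono h0.le h0' fun B => Ex_mono h0.le h0' fun C => ?_
    rw [Finset.sum_boole]
    have : (RR A B C)ᶜ ⊆ Finset.univ.filter (fun d => rep A B C d = 0) := by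
      intro d hd
      rw [Finset.mem_compl] at hd
      exact Finset.mem_filter.mpr ⟨Finset.mem_univ _, mem_RR_of_rep hd⟩
    exact_mod_cast Finset.card_le_card this
  have b8 : EX p0 p1 p2 (fun A B C D E F : Finset G => b01 (ε * n < ((RR A B C)ᶜ.card : ℝ))) ≤ δ := by
    have ha : 0 < ε * n := by positivity
    refine (EX_mono h0.le h0' h1.le h1' h2.le h2' fun A B C D E F =>
      b01_markov ha (hcard0 _)).trans ?_
    simp only [EX, Ex_const, Ex_mul_right]
    rw [← div_eq_mul_inv, div_le_iff₀ ha]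
    refine hRw.trans ?_
    have : n * w ≤ n * (ε * δ / 4) := by gcongr
    nlinarith [mul_pos hn0 (mul_pos hε hδ)]
  have b9 : EX p0 p1 p2 (fun A B C D E F : Finset G =>
      b01 (ε * p1 * n / 4 < ((D \ RR A B C).card : ℝ))) ≤ δ := by
    have ha : 0 < ε * p1 * n / 4 := by positivity
    refine (EX_mono h0.le h0' h1.le h1' h2.le h2' fun A B C D E F =>
      b01_markov ha (hcard0 _)).trans ?_
    have e : ∀ A B C : Finset G, Ex p1 (fun D => ((D \ RR A B C).card : ℝ))
        = p1 * ((RR A B C)ᶜ.card : ℝ) := by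
      intro A B C
      have : ∀ D : Finset G, ((D \ RR A B C).card : ℝ) = ∑ x ∈ (RR A B C)ᶜ, ind D x := by
        intro D
        have q : D \ RR A B C = (RR A B C)ᶜ.filter (fun x => x ∈ D) := by
          ext x; simp [and_comm]
        simp only [ind]
        rw [Finset.sum_boole, q]
      simp_rw [this, Ex_sum, Ex_ind]
      simp [mul_comm]
    simp only [EX, Ex_const, Ex_mul_right, e, Ex_mul_left]
    rw [← div_eq_mul_inv, div_le_iff₀ ha]
    have h3 : p1 * Ex p0 (fun A : Finset G => Ex p0 (fun B => Ex p0 (fun C =>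
        ((RR A B C)ᶜ.card : ℝ)))) ≤ p1 * (n * (ε * δ / 4)) := by
      gcongr
      refine hRw.trans ?_
      gcongr
    refine h3.trans (le_of_eq (by ring))
  have b10 : EX p0 p1 p2 (fun A B C D E F : Finset G => b01 (X < ∑ d, rep D A E d ^ 2)) ≤ δ := by
    refine (EX_mono h0.le h0' h1.le h1' h2.le h2' fun A B C D E F =>
      b01_markov hX0 (Finset.sum_nonneg fun d _ => sq_nonneg _)).trans ?_
    simp only [EX, Ex_const, Ex_mul_right]
    rw [Ex_comm]
    simp only [Ex_sum]
    rw [← div_eq_mul_inv, div_le_iff₀ hX0]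
    calc _ ≤ ∑ d : G, (n ^ 2 * (p1 * p0 * p2)) ^ 2 * 2 := by
          refine Finset.sum_le_sum fun d _ => ?_
          refine (Ex_rep_sq_le' h0 (h02.trans h21) le_rfl h02 h1' h0' h2' d).trans ?_
          rw [← hn]
          gcongr
          linarith
      _ = δ * X := by
          rw [Finset.sum_const, nsmul_eq_mul, Finset.card_univ, ← hn, hX]
          field_simp
  have b11 : EX p0 p1 p2 (fun A B C D E F : Finset G =>
      b01 (SizeOK p0 p1 δ A B C D ∧ BadS X ε e1 Z A B C D E F)) ≤ δ := by
    refine Ex_le_const h0.le h0' fun A => Ex_le_const h0.le h0' fun B => Ex_le_const h0.le h0' fun C =>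
      Ex_le_const h1.le h1' fun D => ?_
    exact badS_bound Z hZ0 h0 h1 h2 h2' hδ hε hbig A B C D
  linarith

end core

section conclusion

lemma exists_net {e1 : ℝ} (he1 : 0 < e1) : ∃ Z : Finset ℂ, 0 < Z.card ∧ (∀ z ∈ Z, ‖z‖ = 1) ∧
    ∀ z : ℂ, ‖z‖ = 1 → ∃ w ∈ Z, ‖z - w‖ ≤ e1 := by
  obtain ⟨t, hts, htf, hcov⟩ := (isCompact_sphere (0 : ℂ) 1).finite_cover_balls he1
  have h2 : ∀ z : ℂ, ‖z‖ = 1 → ∃ w ∈ htf.toFinset, ‖z - w‖ ≤ e1 := by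
    intro z hz
    have := hcov (show z ∈ Metric.sphere (0 : ℂ) 1 by simp [hz])
    simp only [Set.mem_iUnion, Metric.mem_ball, dist_eq_norm] at this
    obtain ⟨w, hw, hlt⟩ := this
    exact ⟨w, htf.mem_toFinset.mpr hw, hlt.le⟩
  refine ⟨htf.toFinset, ?_, ?_, h2⟩
  · obtain ⟨w, hw, -⟩ := h2 1 (by simp)
    exact Finset.card_pos.mpr ⟨w, hw⟩
  · intro z hz
    have := hts (htf.mem_toFinset.mp hz)
    simpa using this

lemma exp_neg_le_inv {x d : ℝ} (hd : 0 < d) (hx : 1 / d ≤ x) : Real.exp (-x) ≤ d := by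
  have hx0 : 0 < x := lt_of_lt_of_le (by positivity) hx
  rw [Real.exp_neg]
  have h1 : x ≤ Real.exp x := by linarith [Real.add_one_le_exp x]
  rw [inv_le_comm₀ (Real.exp_pos _) hd]
  rw [one_div] at hx
  linarith

set_option maxHeartbeats 2000000 in
lemma main_prob (τ δ : ℝ) (hτ : 0 < τ) (hδ : 0 < δ) : ∃ S : ℝ, 1 ≤ S ∧
    ∀ (G : Type) [AddCommGroup G] [Fintype G] (p : ℝ), 0 < p → p ≤ 1 →
      S ≤ p * Fintype.card G → S ≤ p ^ 3 * (Fintype.card G : ℝ) ^ 2 →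
      1 - δ ≤ Ex p (fun U : Finset G => b01 (0 < U.card ∧ Corr (1 - τ) U)) := by
  obtain ⟨d, hd0, hd1, hdδ⟩ : ∃ d : ℝ, 0 < d ∧ d ≤ 1 ∧ 11 * d ≤ δ := by
    refine ⟨min δ 1 / 12, by positivity, ?_, ?_⟩
    · linarith [min_le_right δ 1]
    · linarith [min_le_left δ 1]
  obtain ⟨ε, hε0, hε1, hετ⟩ : ∃ ε : ℝ, 0 < ε ∧ ε ≤ 1 ∧ 24 * ε ≤ τ := by
    refine ⟨min τ 1 / 24, by positivity, ?_, ?_⟩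
    · linarith [min_le_right τ 1]
    · linarith [min_le_left τ 1]
  obtain ⟨Z, hZ0, hZ1, hZ⟩ := exists_net hε0
  set L := Real.log Z.card with hL
  have hL0 : 0 ≤ L := Real.log_natCast_nonneg _
  obtain ⟨k2, hk2⟩ : ∃ k2, k2 = ε * d / 40 := ⟨_, rfl⟩
  obtain ⟨c, hc⟩ : ∃ c, c = ε ^ 2 * d / 32768 := ⟨_, rfl⟩
  obtain ⟨k0, hk0⟩ : ∃ k0, k0 = k2 * (c * d / (6 * (L + 1))) := ⟨_, rfl⟩
  have hεd : ε * d ≤ 1 := by nlinarith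
  have hk2p : 0 < k2 := by rw [hk2]; positivity
  have hk2l : k2 ≤ 1 / 40 := by rw [hk2]; linarith
  have hcp : 0 < c := by rw [hc]; positivity
  have hcε : c ≤ ε / 4 := by
    rw [hc]; nlinarith [mul_le_mul_of_nonneg_left hεd hε0.le]
  have hk0p : 0 < k0 := by rw [hk0]; positivity
  have hk02 : k0 ≤ k2 := by
    rw [hk0]
    have : c * d / (6 * (L + 1)) ≤ 1 := by
      rw [div_le_one (by positivity)]
      nlinarith
    nlinarith
  have hk0L : 3 * k0 / d * L ≤ k2 * c / 2 := by
    have : 3 * k0 / d * L = k2 * c / 2 * (L / (L + 1)) := by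
      rw [hk0]; field_simp; ring
    rw [this]
    have h1 : L / (L + 1) ≤ 1 := by rw [div_le_one (by positivity)]; linarith
    have h2 : 0 ≤ k2 * c / 2 := by positivity
    nlinarith
  obtain ⟨S, hS1, hS2, hS3, hS4⟩ : ∃ S : ℝ, 1 ≤ S ∧ (3 / k0 + 4 / k0 ^ 3) * (4 / (ε * d)) ≤ S ∧
      4 / (k0 * d) ≤ S ∧ 4 / (k2 * c * d) ≤ S := by
    refine ⟨1 + (3 / k0 + 4 / k0 ^ 3) * (4 / (ε * d)) + 4 / (k0 * d) + 4 / (k2 * c * d), ?_, ?_, ?_, ?_⟩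
    all_goals
      have q1 : 0 ≤ (3 / k0 + 4 / k0 ^ 3) * (4 / (ε * d)) := by positivity
      have q2 : 0 ≤ 4 / (k0 * d) := by positivity
      have q3 : 0 ≤ 4 / (k2 * c * d) := by positivity
      linarith
  have hS0 : 0 < S := by linarith
  refine ⟨S, hS1, ?_⟩
  intro G _ _ p hp0 hp1 hSn hSn3
  set n : ℝ := (Fintype.card G : ℝ) with hn
  have hn0 : 0 < n := by rw [hn]; exact_mod_cast Fintype.card_pos
  obtain ⟨p0, hp0d⟩ : ∃ p0, p0 = k0 * p := ⟨_, rfl⟩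
  obtain ⟨p2, hp2d⟩ : ∃ p2, p2 = k2 * p := ⟨_, rfl⟩
  have h0 : 0 < p0 := by rw [hp0d]; positivity
  have h02 : p0 ≤ p2 := by rw [hp0d, hp2d]; gcongr
  have h2p : p2 ≤ p / 40 := by rw [hp2d]; nlinarith
  have h2 : 0 < p2 := h0.trans_le h02
  obtain ⟨P, hP⟩ : ∃ P, P = (1 - p0) ^ 3 * (1 - p2) ^ 2 := ⟨_, rfl⟩
  have hP1 : 1 - 5 * p2 ≤ P := by
    have hb := one_add_mul_le_pow (show (-2 : ℝ) ≤ -p2 by linarith) 5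
    have h3 : (1 - p2) ^ 3 ≤ (1 - p0) ^ 3 := by
      apply pow_le_pow_left₀ <;> linarith
    have h4 : (1 - p2) ^ 3 * (1 - p2) ^ 2 ≤ P := by
      rw [hP]; gcongr
    have h5 : (1 - p2) ^ 3 * (1 - p2) ^ 2 = (1 + -p2) ^ 5 := by ring
    push_cast at hb
    linarith
  have hPp : 0 < P := by linarith
  obtain ⟨p1, hp1d⟩ : ∃ p1, p1 = 1 - (1 - p) / P := ⟨_, rfl⟩
  have hp1' : p1 ≤ 1 := by
    rw [hp1d]
    have : 0 ≤ (1 - p) / P := div_nonneg (by linarith) hPp.le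
    linarith
  have hp1l : p / 2 ≤ p1 := by
    rw [hp1d]
    have : (1 - p) / P ≤ 1 - p / 2 := by
      rw [div_le_iff₀ hPp]
      nlinarith
    linarith
  have hw : 3 / (p0 * n) + 4 / (p0 ^ 3 * n ^ 2) ≤ ε * d / 4 := by
    have e1 : 3 / (p0 * n) ≤ 3 / k0 / S := by
      rw [div_div, hp0d]
      have : k0 * S ≤ k0 * p * n := by rw [mul_assoc]; gcongr
      gcongr
    have e2 : 4 / (p0 ^ 3 * n ^ 2) ≤ 4 / k0 ^ 3 / S := by
      rw [div_div, hp0d]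
      have : k0 ^ 3 * S ≤ (k0 * p) ^ 3 * n ^ 2 := by rw [mul_pow, mul_assoc]; gcongr
      gcongr
    have e3 : (3 / k0 + 4 / k0 ^ 3) / S ≤ ε * d / 4 := by
      rw [div_le_iff₀ hS0]
      have := mul_le_mul_of_nonneg_left hS2 (show 0 ≤ ε * d / 4 by positivity)
      refine le_trans (le_of_eq ?_) this
      field_simp
    rw [add_div] at e3
    linarith
  have hco := core (G := G) (p := p) (p0 := p0) (p1 := p1) (p2 := p2) (δ := d) (ε := ε) (e1 := ε)
    (τ := τ) Z hZ0 h0 h02 (by linarith) hp1' hd0 hε0 hε0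
    (by
      have e : (1 - p0) ^ 3 * (1 - p1) * (1 - p2) ^ 2 = P * (1 - p1) := by rw [hP]; ring
      rw [e, hp1d]
      field_simp
      ring) hZ1 hZ (by linarith) (by rw [← hn]; linarith) (by rw [← hn]; exact hw)
    (by
      rw [← hn]
      apply exp_neg_le_inv hd0
      have : k0 * S ≤ p0 * n := by rw [hp0d, mul_assoc]; gcongr
      have h3 : k0 * (4 / (k0 * d)) ≤ k0 * S := by gcongr
      have h4 : k0 * (4 / (k0 * d)) = 4 * (1 / d) := by field_simp
      linarith)
    (by
      have e1 : 3 * (p0 / d) + 2 * (p2 / d) ≤ 5 * (p2 / d) := by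
        have : p0 / d ≤ p2 / d := by gcongr
        linarith
      have e2 : 5 * (p2 / d) = ε * (p / 8) := by
        rw [hp2d, hk2]; field_simp; norm_num
      have e3 : ε * (p / 8) ≤ ε * (p1 / 4) :=
        mul_le_mul_of_nonneg_left (by linarith) hε0.le
      linarith)
    (by
      rw [← hn, ← hL]
      set y := p * n with hy
      have hy0 : 0 < y := by positivity
      have e1 : 3 * (p0 * n / d) * L = (3 * k0 / d * L) * y := by rw [hp0d, hy]; ring
      have e2 : (3 * k0 / d * L) * y ≤ k2 * c / 2 * y := by gcongr
      have e3 : Real.exp (-(p2 * (ε * n) / 4)) ≤ Real.exp (-(k2 * c * y)) := by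
        apply Real.exp_le_exp.mpr
        have : p2 * (ε * n) / 4 = k2 * (ε / 4) * y := by rw [hp2d, hy]; ring
        rw [this, neg_le_neg_iff]
        gcongr
      have e4 : Real.exp (-(p2 * (ε ^ 2 * d * n / 8192) / 4)) = Real.exp (-(k2 * c * y)) := by
        congr 2
        rw [hp2d, hc, hy]; ring
      calc _ ≤ Real.exp (k2 * c / 2 * y) * (Real.exp (-(k2 * c * y)) + Real.exp (-(k2 * c * y))) := by
            rw [e1, e4]
            gcongr
        _ = 2 * Real.exp (-(k2 * c / 2 * y)) := by
            have : Real.exp (k2 * c / 2 * y) * Real.exp (-(k2 * c * y))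
              = Real.exp (-(k2 * c / 2 * y)) := by
              rw [← Real.exp_add]; congr 1; ring
            rw [← two_mul, mul_left_comm, this]
        _ ≤ 2 * (d / 2) := by
            gcongr
            apply exp_neg_le_inv (by positivity)
            have h3 : k2 * c / 2 * (4 / (k2 * c * d)) ≤ k2 * c / 2 * y := by
              gcongr; exact hS4.trans hSn
            refine le_trans (le_of_eq ?_) h3
            field_simp
            norm_num
        _ = d := by ring)
  linarith

end conclusion

theorem almost_all_twelve_tuples_respected (η : ℝ) (hη : 0 < η) :
    ∃ C : ℝ, 0 < C ∧ ∀ δ : ℝ, 0 < δ → ∃ n₀ : ℕ,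
      ∀ (G : Type) [AddCommGroup G] [Fintype G], n₀ ≤ Fintype.card G →
        1 - δ ≤ randomSubsetProb G
            (C * (Fintype.card G : ℝ) ^ (-(2 : ℝ) / 3) *
              Real.log (Fintype.card G) ^ ((1 : ℝ) / 3))
            (fun U => ∀ (H : Type) [AddCommGroup H] [AddGroup.FG H] (φ : G → H),
              FreimanHomOn U φ →
                1 - 36 * η ≤
                  (∑ q ∈ Gam12 G,
                    (∏ i, charMeas U (q.1 i)) * (∏ i, charMeas U (q.2 i)) *
                      (if (∀ i, q.1 i ∈ U) ∧ (∀ i, q.2 i ∈ U) ∧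
                          (∑ i, φ (q.1 i)) = (∑ i, φ (q.2 i)) then 1 else 0)) /
                    ((Gam12 G).card : ℝ)) := by


  refine ⟨1, one_pos, fun δ hδ => ?_⟩
  obtain ⟨S, hS1, hS⟩ := main_prob (3 * η) δ (by positivity) hδ
  refine ⟨⌈Real.exp (S ^ 2)⌉₊ + 1, ?_⟩
  intro G _ _ hn0
  set n : ℝ := (Fintype.card G : ℝ) with hn
  have hnS : Real.exp (S ^ 2) ≤ n := by
    have h1 := Nat.le_ceil (Real.exp (S ^ 2))
    have h2 : ((⌈Real.exp (S ^ 2)⌉₊ + 1 : ℕ) : ℝ) ≤ n := by rw [hn]; exact_mod_cast hn0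
    push_cast at h2
    linarith
  have hnpos : 0 < n := lt_of_lt_of_le (Real.exp_pos _) hnS
  have hlog : S ^ 2 ≤ Real.log n := (Real.le_log_iff_exp_le hnpos).mpr hnS
  have hlog0 : 0 < Real.log n := by nlinarith
  set p := 1 * n ^ (-(2 : ℝ) / 3) * Real.log n ^ ((1 : ℝ) / 3) with hp
  have hp0 : 0 < p := by positivity
  have hp3 : p ^ 3 * n ^ 2 = Real.log n := by
    have e1 : (n ^ (-(2 : ℝ) / 3)) ^ 3 = (n ^ 2)⁻¹ := by
      rw [← Real.rpow_natCast, ← Real.rpow_mul hnpos.le]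
      norm_num
    have e2 : (Real.log n ^ ((1 : ℝ) / 3)) ^ 3 = Real.log n := by
      rw [← Real.rpow_natCast, ← Real.rpow_mul hlog0.le]
      norm_num
    rw [hp, one_mul, mul_pow, e1, e2]
    field_simp
  have hn1 : 1 ≤ n := le_trans (Real.one_le_exp (by positivity)) hnS
  have hp1 : p ≤ 1 := by
    by_contra hlt
    push Not at hlt
    have h1 : 1 < p ^ 3 := one_lt_pow₀ hlt (by norm_num)
    have h2 : Real.log n ≤ n - 1 := Real.log_le_sub_one_of_pos hnpos
    nlinarith [sq_nonneg n]
  have hSn3 : S ≤ p ^ 3 * n ^ 2 := by rw [hp3]; nlinarith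
  have hSn : S ≤ p * n := by
    have h1 : S ^ 2 ≤ (p * n) ^ 2 := by
      calc S ^ 2 ≤ p ^ 3 * n ^ 2 := by rw [hp3]; exact hlog
        _ ≤ p ^ 2 * n ^ 2 := by
          exact mul_le_mul_of_nonneg_right (pow_le_pow_of_le_one hp0.le hp1 (by norm_num)) (sq_nonneg n)
        _ = _ := by ring
    exact le_of_sq_le_sq h1 (by positivity)
  refine (hS G p hp0 hp1 hSn hSn3).trans ?_
  have hprob : ∀ E : Finset G → Prop, randomSubsetProb G p E = Ex p (fun U => b01 (E U)) := by
    intro E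
    simp only [randomSubsetProb, Ex, b01, mul_ite, mul_one, mul_zero]
  rw [hprob]
  refine Ex_mono hp0.le hp1 fun U => b01_mono ?_
  rintro ⟨hU0, hU⟩ H _ _ φ hφ
  by_cases h36 : 1 - 36 * η ≤ 0
  · refine h36.trans (div_nonneg (Finset.sum_nonneg fun q _ => ?_) (Nat.cast_nonneg _))
    have hc : ∀ x, 0 ≤ charMeas U x := by
      intro x; unfold charMeas; split_ifs <;> positivity
    refine mul_nonneg (mul_nonneg (Finset.prod_nonneg fun i _ => hc _)
      (Finset.prod_nonneg fun i _ => hc _)) ?_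
    split_ifs <;> norm_num
  · push Not at h36
    refine le_trans ?_ (final_bound (t := 1 - 3 * η) (by linarith) U hU0 hU φ hφ)
    have := one_add_mul_le_pow (show (-2 : ℝ) ≤ -(3 * η) by linarith) 12
    have e : (1 + -(3 * η)) ^ 12 = (1 - 3 * η) ^ 12 := by ring
    push_cast at this
    linarith

end
end

section
/- Let H be an Abelian group, let 0 ≤ β ≤ 1/2, and let p, q, r, s be non-negative finitely supported real-valued functions on H such that Σ_h p(h), Σ_h q(h), Σ_h r(h), Σ_h s(h) are all at most 1 + β. Then d(p * r, q * s) ≤ (1 + β)^2 (d(p, q) + d(r, s)) + 8β^2, where d(p, q) = 1 − ⟨p, q⟩. -/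
open scoped Classical

noncomputable section

/-- The convolution `(p * q)(h) = Σ_{h₁ + h₂ = h} p(h₁) q(h₂)` of finitely supported
functions on an Abelian group. -/
def fconv {H : Type*} [AddCommGroup H] (p q : H → ℝ) (h : H) : ℝ :=
  ∑ᶠ h₁, p h₁ * q (h - h₁)

theorem sum_mul_le_aux {H : Type*} (S : Finset H) (u v : H → ℝ)
    (hu : ∀ h, 0 ≤ u h) (hv : ∀ h, 0 ≤ v h) :
    ∑ a ∈ S, u a * v a ≤ (∑ a ∈ S, u a) * ∑ a ∈ S, v a := by
  rw [Finset.sum_mul]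
  refine Finset.sum_le_sum fun a ha => mul_le_mul_of_nonneg_left ?_ (hu a)
  exact Finset.single_le_sum (f := v) (fun i _ => hv i) ha

theorem convolution_approximately_lipschitz {H : Type*} [AddCommGroup H]
    (β : ℝ) (hβ0 : 0 ≤ β) (hβ1 : β ≤ 1 / 2)
    (p q r s : H → ℝ)
    (hpfin : (Function.support p).Finite) (hqfin : (Function.support q).Finite)
    (hrfin : (Function.support r).Finite) (hsfin : (Function.support s).Finite)
    (hp0 : ∀ h, 0 ≤ p h) (hq0 : ∀ h, 0 ≤ q h) (hr0 : ∀ h, 0 ≤ r h) (hs0 : ∀ h, 0 ≤ s h)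
    (hps : ∑ᶠ h, p h ≤ 1 + β) (hqs : ∑ᶠ h, q h ≤ 1 + β)
    (hrs : ∑ᶠ h, r h ≤ 1 + β) (hss : ∑ᶠ h, s h ≤ 1 + β) :
    1 - ∑ᶠ h, fconv p r h * fconv q s h ≤
      (1 + β) ^ 2 * ((1 - ∑ᶠ h, p h * q h) + (1 - ∑ᶠ h, r h * s h)) + 8 * β ^ 2 := by
  obtain ⟨S, hS⟩ : ∃ S : Finset H, ∀ h, h ∉ S → p h = 0 ∧ q h = 0 ∧ r h = 0 ∧ s h = 0 := by
    refine ⟨hpfin.toFinset ∪ hqfin.toFinset ∪ hrfin.toFinset ∪ hsfin.toFinset, fun h hh => ?_⟩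
    simp only [Finset.mem_union, Set.Finite.mem_toFinset, Function.mem_support] at hh
    tauto
  have key : ∀ f : H → ℝ, (∀ h, h ∉ S → f h = 0) → ∑ᶠ h, f h = ∑ h ∈ S, f h := by
    intro f hf
    refine finsum_eq_sum_of_support_subset f fun h hh => ?_
    by_contra hc
    exact hh (hf h hc)
  have ep : ∑ᶠ h, p h = ∑ h ∈ S, p h := key _ fun h hh => (hS h hh).1
  have eq' : ∑ᶠ h, q h = ∑ h ∈ S, q h := key _ fun h hh => (hS h hh).2.1
  have er : ∑ᶠ h, r h = ∑ h ∈ S, r h := key _ fun h hh => (hS h hh).2.2.1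
  have es : ∑ᶠ h, s h = ∑ h ∈ S, s h := key _ fun h hh => (hS h hh).2.2.2
  have epq : ∑ᶠ h, p h * q h = ∑ h ∈ S, p h * q h := key _ fun h hh => by simp [(hS h hh).1]
  have ers : ∑ᶠ h, r h * s h = ∑ h ∈ S, r h * s h := key _ fun h hh => by simp [(hS h hh).2.2.1]
  have fpr : ∀ h, fconv p r h = ∑ a ∈ S, p a * r (h - a) := fun h =>
    key _ fun a ha => by simp [(hS a ha).1]
  have fqs : ∀ h, fconv q s h = ∑ a ∈ S, q a * s (h - a) := fun h =>
    key _ fun a ha => by simp [(hS a ha).2.1]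
  let U : Finset H := (S ×ˢ S).image fun x => x.1 + x.2
  have hU : ∀ h, h ∉ U → ∀ a ∈ S, r (h - a) = 0 := by
    intro h hh a ha
    refine (hS (h - a) fun hc => hh ?_).2.2.1
    exact Finset.mem_image.2 ⟨(a, h - a), Finset.mem_product.2 ⟨ha, hc⟩, by simp⟩
  have eall : ∑ᶠ h, fconv p r h * fconv q s h = ∑ h ∈ U, fconv p r h * fconv q s h := by
    refine finsum_eq_sum_of_support_subset _ fun h hh => ?_
    by_contra hc
    apply hh
    have : fconv p r h = 0 := by
      rw [fpr]
      exact Finset.sum_eq_zero fun a ha => by rw [hU h hc a ha, mul_zero]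
    simp [this]
  have hshift : ∀ a ∈ S, ∑ h ∈ U, r (h - a) * s (h - a) = ∑ᶠ h, r h * s h := by
    intro a ha
    rw [← finsum_comp_equiv (Equiv.subRight a) (f := fun h => r h * s h)]
    symm
    refine finsum_eq_sum_of_support_subset _ fun h hh => ?_
    by_contra hc
    apply hh
    simp [hU h hc a ha]
  have hmain : (∑ᶠ h, p h * q h) * (∑ᶠ h, r h * s h) ≤ ∑ᶠ h, fconv p r h * fconv q s h := by
    rw [eall, epq, Finset.sum_mul]
    calc ∑ a ∈ S, p a * q a * (∑ᶠ h, r h * s h)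
        = ∑ a ∈ S, ∑ h ∈ U, (p a * r (h - a)) * (q a * s (h - a)) := by
          refine Finset.sum_congr rfl fun a ha => ?_
          rw [← hshift a ha, Finset.mul_sum]
          exact Finset.sum_congr rfl fun h _ => by ring
      _ = ∑ h ∈ U, ∑ a ∈ S, (p a * r (h - a)) * (q a * s (h - a)) := Finset.sum_comm
      _ ≤ _ := by
          refine Finset.sum_le_sum fun h _ => ?_
          rw [fpr, fqs]
          exact sum_mul_le_aux S _ _ (fun a => mul_nonneg (hp0 _) (hr0 _))
            (fun a => mul_nonneg (hq0 _) (hs0 _))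
  have hx : ∑ᶠ h, p h * q h ≤ (1 + β) * (1 + β) := by
    rw [epq]
    rw [ep] at hps
    rw [eq'] at hqs
    exact (sum_mul_le_aux S p q hp0 hq0).trans
      (mul_le_mul hps hqs (Finset.sum_nonneg fun i _ => hq0 i) (by linarith))
  have hy : ∑ᶠ h, r h * s h ≤ (1 + β) * (1 + β) := by
    rw [ers]
    rw [er] at hrs
    rw [es] at hss
    exact (sum_mul_le_aux S r s hr0 hs0).trans
      (mul_le_mul hrs hss (Finset.sum_nonneg fun i _ => hs0 i) (by linarith))
  generalize (∑ᶠ h, p h * q h) = x at *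
  generalize (∑ᶠ h, r h * s h) = y at *
  have h1 := mul_nonneg (sub_nonneg.2 hx) (sub_nonneg.2 hy)
  have h2 : β ^ 2 * (2 + β) ^ 2 ≤ β ^ 2 * 8 :=
    mul_le_mul_of_nonneg_left (by nlinarith) (sq_nonneg β)
  nlinarith

end
end
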